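/- As n → ∞, v(n) ~ e^{π√n}/(16·n^{3/4}), and equivalently v(n) ~ (n^{1/4}/2)·p̄(n), where in each case the ratio of the two sides tends to 1. -/

import Mathlib

open Complex Real Filter Topology

noncomputable section

/-- An odd-balanced unimodal sequence, encoded as (left list `L`, peak `p`, right list `R`):
all parts positive, the peak `p` is even and strictly larger than all other parts,
the left side is weakly increasing and the right side weakly decreasing, repeated
(i.e. equal consecutive) parts are allowed only when they are odd, and the odd parts
before the peak are identical to the odd parts after the peak. -/
def IsOddBalanced (L : List ℕ) (p : ℕ) (R : List ℕ) : Prop :=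
  Even p ∧ 0 < p ∧ (∀ x ∈ L, 0 < x) ∧ (∀ x ∈ R, 0 < x) ∧
  L.Chain' (fun a b => a ≤ b ∧ (a = b → Odd a)) ∧
  R.Chain' (fun a b => b ≤ a ∧ (a = b → Odd a)) ∧
  (∀ x ∈ L, x < p) ∧ (∀ x ∈ R, x < p) ∧
  L.filter (fun x => x % 2 == 1) = R.reverse.filter (fun x => x % 2 == 1)

/-- `v(m,n)`: number of odd-balanced unimodal sequences of size `2n+2` and rank `m`. -/
def oddBalancedCount (m : ℤ) (n : ℕ) : ℕ :=
  Nat.card {x : List ℕ × ℕ × List ℕ //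
    IsOddBalanced x.1 x.2.1 x.2.2 ∧ x.1.sum + x.2.1 + x.2.2.sum = 2 * n + 2 ∧
    (x.2.2.length : ℤ) - (x.1.length : ℤ) = m}

/-- `v(a,c;n)`: number of odd-balanced unimodal sequences of size `2n+2`
whose rank is congruent to `a` modulo `c`. -/
def oddBalancedCountMod (a : ℤ) (c : ℕ) (n : ℕ) : ℕ :=
  Nat.card {x : List ℕ × ℕ × List ℕ //
    IsOddBalanced x.1 x.2.1 x.2.2 ∧ x.1.sum + x.2.1 + x.2.2.sum = 2 * n + 2 ∧
    (x.2.2.length : ℤ) - (x.1.length : ℤ) ≡ a [ZMOD (c : ℤ)]}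

/-- `v(n)`: total number of odd-balanced unimodal sequences of size `2n+2`. -/
def oddBalancedTotal (n : ℕ) : ℕ :=
  Nat.card {x : List ℕ × ℕ × List ℕ //
    IsOddBalanced x.1 x.2.1 x.2.2 ∧ x.1.sum + x.2.1 + x.2.2.sum = 2 * n + 2}

/-- Overpartition function `p̄(n)`: each partition of `n` is counted with
multiplicity `2^(number of distinct parts)` (the overlined parts), which matches the
generating function `∏ (1+qⁿ)/(1-qⁿ)`. -/
def overpartition (n : ℕ) : ℕ := ∑ p : n.Partition, 2 ^ p.parts.toFinset.card

lemma tb_term_integral (n m : ℕ) :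
    ∫ θ in (-π)..π, cexp (((n : ℂ) - m) * I * θ) = if n = m then (2 * π : ℂ) else 0 := by
  split_ifs with h
  · subst h
    simp
    norm_cast
    ring
  · have hc : ((n : ℂ) - m) * I ≠ 0 := by
      refine mul_ne_zero (sub_ne_zero.mpr ?_) I_ne_zero
      exact_mod_cast h
    rw [integral_exp_mul_complex hc]
    have : cexp (((n : ℂ) - m) * I * (π : ℝ)) = cexp (((n : ℂ) - m) * I * ((-π : ℝ) : ℂ)) := by
      rw [Complex.exp_eq_exp_iff_exists_int]
      refine ⟨(n : ℤ) - m, ?_⟩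
      push_cast
      ring
    rw [this]
    simp

lemma tb_continuous (c : ℕ → ℝ) (F : ℂ → ℂ)
    (hF : ∀ z : ℂ, 0 < z.re → HasSum (fun n : ℕ => (c n : ℂ) * cexp (-(n * z))) (F z))
    (t : ℝ) (ht : 0 < t) : Continuous (fun θ : ℝ => F (t + θ * I)) := by
  have h1 : (fun θ : ℝ => F (t + θ * I)) =
      fun θ : ℝ => ∑' n : ℕ, (c n : ℂ) * cexp (-(n * (t + θ * I))) := by
    funext θ
    exact ((hF _ (by simp [ht])).tsum_eq).symm
  rw [h1]
  have hs : Summable (fun n : ℕ => ‖(c n : ℂ) * cexp (-(n * (t : ℂ)))‖) :=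
    (hF t (by simp [ht])).summable.norm
  refine continuous_tsum (fun n => by fun_prop) hs (fun n θ => ?_)
  apply le_of_eq
  simp [Complex.norm_exp]

lemma tb_coeff (c : ℕ → ℝ) (F : ℂ → ℂ)
    (hF : ∀ z : ℂ, 0 < z.re → HasSum (fun n : ℕ => (c n : ℂ) * cexp (-(n * z))) (F z))
    (t : ℝ) (ht : 0 < t) (n : ℕ) :
    ∫ θ in (-π)..π, F (t + θ * I) * cexp (n * (t + θ * I)) = 2 * π * c n := by
  have hs : Summable (fun m : ℕ => ‖(c m : ℂ) * cexp (-(m * (t : ℂ)))‖) :=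
    (hF t (by simp [ht])).summable.norm
  have key := intervalIntegral.hasSum_integral_of_dominated_convergence
    (μ := MeasureTheory.volume) (a := -π) (b := π)
    (F := fun (m : ℕ) (θ : ℝ) => (c m : ℂ) * cexp (-(m * (t + θ * I))) * cexp (n * (t + θ * I)))
    (f := fun θ : ℝ => F (t + θ * I) * cexp (n * (t + θ * I)))
    (bound := fun m _ => ‖(c m : ℂ) * cexp (-(m * (t : ℂ)))‖ * Real.exp (n * t))
    (fun m => by
      apply Continuous.aestronglyMeasurable
      fun_prop)
    (fun m => by
      refine Eventually.of_forall (fun θ _ => le_of_eq ?_)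
      simp [Complex.norm_exp])
    (Eventually.of_forall fun θ _ => hs.mul_right _)
    (by simp)
    (Eventually.of_forall fun θ _ => (hF _ (by simp [ht])).mul_right _)
  have h2 : ∀ m : ℕ, (∫ θ in (-π)..π, (c m : ℂ) * cexp (-(m * (t + θ * I))) *
      cexp (n * (t + θ * I))) = if m = n then 2 * π * (c n : ℂ) else 0 := by
    intro m
    have h3 : ∀ θ : ℝ, (c m : ℂ) * cexp (-(m * (t + θ * I))) * cexp (n * (t + θ * I)) =
        (c m : ℂ) * cexp (((n : ℂ) - m) * t) * cexp (((n : ℂ) - m) * I * θ) := by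
      intro θ
      rw [mul_assoc, mul_assoc, ← Complex.exp_add, ← Complex.exp_add]
      congr 2
      ring
    simp_rw [h3]
    rw [intervalIntegral.integral_const_mul, tb_term_integral]
    by_cases h : n = m
    · subst h
      simp
      ring
    · simp [h, Ne.symm h]
  simp_rw [h2] at key
  exact key.unique (hasSum_ite_eq n _)

/-- the limiting Gaussian integral -/
def tbG (A s : ℝ) : ℂ := ∫ y : ℝ, Set.indicator (Set.Ioc (-(s ^ 7)⁻¹) ((s ^ 7)⁻¹))
  (fun y : ℝ => cexp (-(A * y ^ 2 / (1 + (s ^ 8 * y : ℝ) * I)))) y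

lemma tb_re (A x y : ℝ) (hA : 0 < A) (hx : x ^ 2 ≤ 1) :
    ‖cexp (-(A * y ^ 2 / (1 + (x : ℝ) * I)))‖ ≤ Real.exp (-(A / 2) * y ^ 2) := by
  rw [Complex.norm_exp]
  apply Real.exp_le_exp.mpr
  have h1 : ((A : ℂ) * y ^ 2 / (1 + (x : ℝ) * I)) = ((A * y ^ 2 : ℝ) : ℂ) / (1 + (x : ℝ) * I) := by
    push_cast; ring
  rw [h1, Complex.neg_re, Complex.div_re]
  simp only [Complex.ofReal_re, Complex.ofReal_im, Complex.normSq_apply]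
  simp
  have h2 : 0 < 1 + x * x := by nlinarith
  rw [le_div_iff₀ h2]
  have : 0 ≤ A * y ^ 2 := by positivity
  nlinarith

lemma tbG_tendsto (A : ℝ) (hA : 0 < A) :
    Tendsto (tbG A) (𝓝[>] 0) (𝓝 ((√(π / A) : ℝ) : ℂ)) := by
  have hlim : ((√(π / A) : ℝ) : ℂ) = ∫ y : ℝ, cexp (-(A * y ^ 2)) := by
    rw [← integral_gaussian A, ← integral_complex_ofReal]
    congr 1
    funext y
    push_cast
    ring_nf
  rw [hlim]
  unfold tbG
  apply MeasureTheory.tendsto_integral_filter_of_dominated_convergence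
    (bound := fun y => Real.exp (-(A / 2) * y ^ 2))
  · refine Eventually.of_forall (fun s => ?_)
    apply MeasureTheory.AEStronglyMeasurable.indicator _ measurableSet_Ioc
    apply Continuous.aestronglyMeasurable
    refine Complex.continuous_exp.comp (Continuous.neg (Continuous.div (by fun_prop) (by fun_prop) ?_))
    intro y h
    have := congrArg Complex.re h
    simp only [Complex.add_re, Complex.one_re, Complex.re_ofReal_mul, Complex.I_re, mul_zero,
      Complex.zero_re] at this
    norm_num at this
  · filter_upwards [Ioo_mem_nhdsGT (show (0:ℝ) < 1 by norm_num)] with s hs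
    refine Eventually.of_forall (fun y => ?_)
    rw [Set.indicator_apply]
    split_ifs with hy
    · apply tb_re A _ y hA
      have h0 : 0 < s := hs.1
      have h7 : 0 < s ^ 7 := by positivity
      have h1 : |s ^ 7 * y| ≤ 1 := by
        rw [abs_le]
        have := mul_inv_cancel₀ h7.ne'
        constructor <;> nlinarith [hy.1, hy.2]
      have h2 : |s ^ 8 * y| ≤ 1 := by
        have : s ^ 8 * y = s * (s ^ 7 * y) := by ring
        rw [this, abs_mul, abs_of_pos h0]
        nlinarith [hs.2, abs_nonneg (s ^ 7 * y)]
      rw [← sq_abs]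
      nlinarith [abs_nonneg (s ^ 8 * y)]
    · simp; positivity
  · exact integrable_exp_neg_mul_sq (by positivity)
  · refine Eventually.of_forall (fun y => ?_)
    have hev : ∀ᶠ s : ℝ in 𝓝[>] 0, y ∈ Set.Ioc (-(s ^ 7)⁻¹) ((s ^ 7)⁻¹) := by
      have h7 : Tendsto (fun s : ℝ => (s ^ 7)⁻¹) (𝓝[>] 0) atTop := by
        apply Tendsto.inv_tendsto_nhdsGT_zero
        rw [tendsto_nhdsWithin_iff]
        constructor
        · have : Tendsto (fun s : ℝ => s ^ 7) (𝓝 0) (𝓝 (0 ^ 7)) := (continuous_pow 7).tendsto 0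
          simp at this
          exact this.mono_left nhdsWithin_le_nhds
        · filter_upwards [self_mem_nhdsWithin] with s hs
          exact Set.mem_Ioi.mpr (pow_pos (Set.mem_Ioi.mp hs) 7)
      filter_upwards [h7.eventually_gt_atTop |y|] with s hs
      have := abs_lt.mp hs
      exact ⟨this.1, this.2.le⟩
    have hc : Tendsto (fun s : ℝ => cexp (-(A * y ^ 2 / (1 + (s ^ 8 * y : ℝ) * I)))) (𝓝[>] 0)
        (𝓝 (cexp (-(A * y ^ 2 / (1 + ((0 : ℝ) ^ 8 * y : ℝ) * I))))) := by
      apply Tendsto.mono_left _ nhdsWithin_le_nhds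
      refine ContinuousAt.tendsto (f := fun s : ℝ => cexp (-(A * y ^ 2 / (1 + (s ^ 8 * y : ℝ) * I)))) ?_
      refine ContinuousAt.cexp (ContinuousAt.neg (ContinuousAt.div (by fun_prop) (by fun_prop) ?_))
      simp
    have h0 : cexp (-(A * y ^ 2 / (1 + ((0 : ℝ) ^ 8 * y : ℝ) * I))) = cexp (-(A * y ^ 2)) := by
      simp
    rw [h0] at hc
    refine hc.congr' ?_
    filter_upwards [hev] with s hs
    rw [Set.indicator_of_mem hs]

lemma tb_exponent (A s θ : ℝ) (hs : 0 < s) (n : ℕ) (hn : n * s ^ 32 = A) :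
    (A : ℂ) / ((s ^ 16 : ℝ) + θ * I) + n * ((s ^ 16 : ℝ) + θ * I) =
      ((2 * A / s ^ 16 : ℝ) : ℂ) +
        -(A * ((θ / s ^ 24 : ℝ) : ℂ) ^ 2 / (1 + (s ^ 8 * (θ / s ^ 24) : ℝ) * I)) := by
  have h1 : ((s ^ 16 : ℝ) + θ * I : ℂ) ≠ 0 := by
    intro h
    have := congrArg Complex.re h
    simp only [Complex.add_re, Complex.ofReal_re, Complex.re_ofReal_mul, Complex.I_re, mul_zero,
      Complex.zero_re, add_zero] at this
    have : 0 < s ^ 16 := by positivity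
    linarith
  have h2 : (1 + (s ^ 8 * (θ / s ^ 24) : ℝ) * I : ℂ) = ((s ^ 16 : ℝ) + θ * I) / (s ^ 16 : ℝ) := by
    have : (s : ℂ) ≠ 0 := by exact_mod_cast hs.ne'
    push_cast
    field_simp
  have h3 : (s : ℂ) ≠ 0 := by exact_mod_cast hs.ne'
  rw [h2, ← hn]
  push_cast at h1 ⊢
  field_simp
  linear_combination (n * θ ^ 2 : ℂ) * I_sq

lemma tb_bound (c : ℕ → ℝ) (F : ℂ → ℂ)
    (hF : ∀ z : ℂ, 0 < z.re → HasSum (fun n : ℕ => (c n : ℂ) * cexp (-(n * z))) (F z))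
    (A l : ℝ) (hA : 0 < A) (k n : ℕ) (s ε : ℝ) (hs : 0 < s) (hs1 : s < 1) (hn : n * s ^ 32 = A)
    (hε : 0 < ε)
    (hmaj : ∀ θ : ℝ, |θ| ≤ s ^ 17 →
      ‖F ((s ^ 16 : ℝ) + θ * I) * cexp (-(A / ((s ^ 16 : ℝ) + θ * I))) / (s ^ k : ℝ) - l‖ ≤ ε)
    (hmin : ∀ θ : ℝ, s ^ 17 ≤ |θ| → |θ| ≤ π →
      ‖F ((s ^ 16 : ℝ) + θ * I)‖ ≤ ε * s ^ (24 + k) * Real.exp (A / s ^ 16)) :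
    ‖((2 * π * c n * Real.exp (-(2 * A / s ^ 16)) / s ^ (24 + k) : ℝ) : ℂ) - l * tbG A s‖
      ≤ ε * (2 * π + √(π / (A / 2))) := by
  have ht : 0 < s ^ 16 := by positivity
  set H : ℝ → ℂ := fun θ => F ((s ^ 16 : ℝ) + θ * I) * cexp (n * ((s ^ 16 : ℝ) + θ * I)) with hH
  have hcont : Continuous H := by
    have := tb_continuous c F hF _ ht
    exact this.mul (by fun_prop)
  have hcoeff : ∫ θ in (-π)..π, H θ = 2 * π * c n := tb_coeff c F hF _ ht n
  have hIntble : ∀ a b : ℝ, IntervalIntegrable H MeasureTheory.volume a b :=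
    fun a b => hcont.intervalIntegrable a b
  have hsplit : ∫ θ in (-π)..π, H θ = (∫ θ in (-π)..(-(s ^ 17)), H θ) +
      (∫ θ in (-(s ^ 17))..(s ^ 17), H θ) + ∫ θ in (s ^ 17)..π, H θ := by
    rw [intervalIntegral.integral_add_adjacent_intervals (hIntble _ _) (hIntble _ _),
      intervalIntegral.integral_add_adjacent_intervals (hIntble _ _) (hIntble _ _)]
  have hs17 : s ^ 17 < 1 := pow_lt_one₀ hs.le hs1 (by norm_num)
  have hs17' : 0 < s ^ 17 := by positivity
  have hpi := Real.pi_gt_three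
  -- minor
  have hnt : (n : ℝ) * s ^ 16 = A / s ^ 16 := by
    rw [eq_div_iff ht.ne', ← hn]; ring
  have hmin' : ∀ θ : ℝ, s ^ 17 ≤ |θ| → |θ| ≤ π →
      ‖H θ‖ ≤ ε * s ^ (24 + k) * Real.exp (2 * A / s ^ 16) := by
    intro θ h1 h2
    have h3 : ‖cexp (n * ((s ^ 16 : ℝ) + θ * I))‖ = Real.exp (A / s ^ 16) := by
      rw [Complex.norm_exp, ← hnt]
      congr 1
      rw [← Complex.ofReal_natCast, Complex.re_ofReal_mul, Complex.add_re, Complex.re_ofReal_mul]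
      simp only [Complex.ofReal_re, Complex.I_re, mul_zero, add_zero]
    rw [hH]
    simp only
    rw [norm_mul, h3]
    calc _ ≤ ε * s ^ (24 + k) * Real.exp (A / s ^ 16) * Real.exp (A / s ^ 16) := by
          gcongr
          exact hmin θ h1 h2
      _ = _ := by
          rw [mul_assoc, ← Real.exp_add]
          congr 2
          ring
  set B : ℝ := ε * s ^ (24 + k) * Real.exp (2 * A / s ^ 16) with hB
  have hB0 : 0 < B := by positivity
  have hm1 : ‖∫ θ in (-π)..(-(s ^ 17)), H θ‖ ≤ B * π := by
    have := intervalIntegral.norm_integral_le_of_norm_le_const (a := -π) (b := -(s ^ 17)) (f := H)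
      (C := B) (fun θ hθ => by
        rw [Set.uIoc_of_le (by linarith)] at hθ
        apply hmin' θ
        · rw [abs_of_neg (by linarith [hθ.2])]; linarith [hθ.2]
        · rw [abs_of_neg (by linarith [hθ.2])]; linarith [hθ.1])
    refine this.trans ?_
    gcongr
    rw [abs_of_nonneg (by linarith)]
    linarith
  have hm2 : ‖∫ θ in (s ^ 17)..π, H θ‖ ≤ B * π := by
    have := intervalIntegral.norm_integral_le_of_norm_le_const (a := s ^ 17) (b := π) (f := H)
      (C := B) (fun θ hθ => by
        rw [Set.uIoc_of_le (by linarith)] at hθ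
        apply hmin' θ
        · rw [abs_of_pos (by linarith [hθ.1])]; linarith [hθ.1]
        · rw [abs_of_pos (by linarith [hθ.1])]; linarith [hθ.2])
    refine this.trans ?_
    gcongr
    rw [abs_of_nonneg (by linarith)]
    linarith
  -- major
  set E : ℝ → ℂ := fun y => cexp (-(A * (y : ℂ) ^ 2 / (1 + (s ^ 8 * y : ℝ) * I))) with hE
  have hEcont : Continuous E := by
    refine Complex.continuous_exp.comp (Continuous.neg (Continuous.div (by fun_prop) (by fun_prop) ?_))
    intro y h
    have := congrArg Complex.re h
    simp only [Complex.add_re, Complex.one_re, Complex.re_ofReal_mul, Complex.I_re, mul_zero,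
      Complex.zero_re] at this
    norm_num at this
  set P : ℝ := s ^ k * Real.exp (2 * A / s ^ 16) with hP
  have hP0 : 0 < P := by positivity
  have hHE : ∀ θ : ℝ, H θ = P * ((F ((s ^ 16 : ℝ) + θ * I) *
      cexp (-(A / ((s ^ 16 : ℝ) + θ * I))) / (s ^ k : ℝ)) * E (θ / s ^ 24)) := by
    intro θ
    have h1 := tb_exponent A s θ hs n hn
    have h2 : cexp (n * ((s ^ 16 : ℝ) + θ * I)) = cexp (-(A / ((s ^ 16 : ℝ) + θ * I))) *
        (Real.exp (2 * A / s ^ 16) * E (θ / s ^ 24)) := by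
      rw [hE, Complex.ofReal_exp, ← Complex.exp_add, ← Complex.exp_add, ← h1]
      congr 1
      ring
    have h3 : ((s ^ k : ℝ) : ℂ) ≠ 0 := by
      have : s ^ k ≠ 0 := by positivity
      exact_mod_cast this
    rw [hH, hP]
    simp only
    rw [h2, Complex.ofReal_mul]
    field_simp
  have hscale : ∫ θ in (-(s ^ 17))..(s ^ 17), E (θ / s ^ 24) = (s ^ 24 : ℝ) * tbG A s := by
    rw [intervalIntegral.integral_comp_div (fun y => E y) (by positivity)]
    have e1 : s ^ 17 / s ^ 24 = (s ^ 7)⁻¹ := by field_simp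
    have e2 : -(s ^ 17) / s ^ 24 = -(s ^ 7)⁻¹ := by rw [neg_div, e1]
    rw [e1, e2, intervalIntegral.integral_of_le (by
      have : 0 < (s ^ 7)⁻¹ := by positivity
      linarith)]
    rw [← MeasureTheory.integral_indicator measurableSet_Ioc]
    simp only [Complex.real_smul, tbG, hE]
  have hmaj' : ‖(∫ θ in (-(s ^ 17))..(s ^ 17), H θ) - P * (s ^ 24 : ℝ) * (l * tbG A s)‖ ≤
      P * s ^ 24 * (ε * √(π / (A / 2))) := by
    have e1 : (P * (s ^ 24 : ℝ) * (l * tbG A s) : ℂ) =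
        ∫ θ in (-(s ^ 17))..(s ^ 17), (P * l : ℂ) * E (θ / s ^ 24) := by
      rw [intervalIntegral.integral_const_mul, hscale]
      ring
    rw [e1, ← intervalIntegral.integral_sub (hIntble _ _) (by
      apply Continuous.intervalIntegrable
      fun_prop)]
    have hg : ∀ θ : ℝ, θ ∈ Set.Ioc (-(s ^ 17)) (s ^ 17) → ‖H θ - (P * l : ℂ) * E (θ / s ^ 24)‖ ≤
        P * ε * Real.exp (-(A / 2 / s ^ 48) * θ ^ 2) := by
      intro θ hθ
      have e2 : H θ - (P * l : ℂ) * E (θ / s ^ 24) = P * ((F ((s ^ 16 : ℝ) + θ * I) *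
        cexp (-(A / ((s ^ 16 : ℝ) + θ * I))) / (s ^ k : ℝ) - l) * E (θ / s ^ 24)) := by
        rw [hHE]; ring
      have hab : |θ| ≤ s ^ 17 := abs_le.mpr ⟨hθ.1.le, hθ.2⟩
      rw [e2, norm_mul, norm_mul, Complex.norm_real, Real.norm_of_nonneg hP0.le, mul_assoc P ε]
      gcongr
      · exact hmaj θ hab
      · have := tb_re A (s ^ 8 * (θ / s ^ 24)) (θ / s ^ 24) hA (by
          have : |s ^ 8 * (θ / s ^ 24)| ≤ 1 := by
            have e3 : s ^ 8 * (θ / s ^ 24) = θ / s ^ 16 := by field_simp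
            rw [e3, abs_div, abs_of_pos ht, div_le_one ht]
            refine hab.trans ?_
            have : s ^ 17 = s ^ 16 * s := by ring
            rw [this]
            nlinarith
          rw [← sq_abs]
          nlinarith [abs_nonneg (s ^ 8 * (θ / s ^ 24))])
        refine (le_of_eq ?_).trans (this.trans (le_of_eq ?_))
        · simp [hE]
        · congr 1
          field_simp
    have h4 := intervalIntegral.norm_integral_le_of_norm_le (a := -(s ^ 17)) (b := s ^ 17)
      (by linarith) (μ := MeasureTheory.volume) (Eventually.of_forall hg) (by
        apply Continuous.intervalIntegrable
        fun_prop)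
    refine h4.trans ?_
    rw [intervalIntegral.integral_const_mul]
    have hb : 0 < A / 2 / s ^ 48 := by positivity
    have h5 : ∫ θ in (-(s ^ 17))..(s ^ 17), Real.exp (-(A / 2 / s ^ 48) * θ ^ 2) ≤
        √(π / (A / 2 / s ^ 48)) := by
      rw [← integral_gaussian, intervalIntegral.integral_of_le (by linarith)]
      exact MeasureTheory.setIntegral_le_integral (integrable_exp_neg_mul_sq hb)
        (Eventually.of_forall fun x => (Real.exp_pos _).le)
    have h6 : √(π / (A / 2 / s ^ 48)) = s ^ 24 * √(π / (A / 2)) := by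
      have : π / (A / 2 / s ^ 48) = (s ^ 24) ^ 2 * (π / (A / 2)) := by field_simp
      rw [this, Real.sqrt_mul (by positivity), Real.sqrt_sq (by positivity)]
    rw [h6] at h5
    calc _ ≤ P * ε * (s ^ 24 * √(π / (A / 2))) := by gcongr
      _ = _ := by ring
  -- combine
  have hPs : 0 < P * s ^ 24 := by positivity
  have e5 : ((2 * π * c n * Real.exp (-(2 * A / s ^ 16)) / s ^ (24 + k) : ℝ) : ℂ) =
      (2 * π * c n : ℂ) / ((P * s ^ 24 : ℝ) : ℂ) := by
    rw [hP]
    have : 2 * π * c n * Real.exp (-(2 * A / s ^ 16)) / s ^ (24 + k) =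
      (2 * π * c n) / (s ^ k * Real.exp (2 * A / s ^ 16) * s ^ 24) := by
      rw [Real.exp_neg, pow_add]
      field_simp
    rw [this]
    push_cast
    rfl
  have hPc : ((P * s ^ 24 : ℝ) : ℂ) ≠ 0 := by exact_mod_cast hPs.ne'
  have e6 : ((2 * π * c n * Real.exp (-(2 * A / s ^ 16)) / s ^ (24 + k) : ℝ) : ℂ) - l * tbG A s =
      ((∫ θ in (-π)..(-(s ^ 17)), H θ) + ((∫ θ in (-(s ^ 17))..(s ^ 17), H θ) -
      P * (s ^ 24 : ℝ) * (l * tbG A s)) + ∫ θ in (s ^ 17)..π, H θ) / ((P * s ^ 24 : ℝ) : ℂ) := by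
    rw [e5, ← hcoeff, hsplit, eq_div_iff hPc, sub_mul, div_mul_cancel₀ _ hPc]
    push_cast
    ring
  rw [e6, norm_div, Complex.norm_real, Real.norm_of_nonneg hPs.le, div_le_iff₀ hPs]
  have hBP : B = ε * (P * s ^ 24) := by rw [hB, hP, pow_add]; ring
  calc _ ≤ B * π + P * s ^ 24 * (ε * √(π / (A / 2))) + B * π := by
        refine (norm_add_le _ _).trans (add_le_add ((norm_add_le _ _).trans
          (add_le_add hm1 hmaj')) hm2)
    _ = _ := by rw [hBP]; ring

/-- the scale attached to `n` -/
def tbS (A : ℝ) (n : ℕ) : ℝ := (A / n) ^ ((1 : ℝ) / 32)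

lemma tbS_pos (A : ℝ) (hA : 0 < A) (n : ℕ) (hn : 0 < n) : 0 < tbS A n := by
  unfold tbS; positivity

lemma tbS_pow (A : ℝ) (hA : 0 < A) (n : ℕ) (hn : 0 < n) : n * tbS A n ^ 32 = A := by
  unfold tbS
  have : ((A / n) ^ ((1 : ℝ) / 32)) ^ 32 = A / n := by
    rw [← Real.rpow_natCast, ← Real.rpow_mul (by positivity)]
    norm_num
  rw [this]
  field_simp

lemma tbS_tendsto (A : ℝ) (hA : 0 < A) : Tendsto (tbS A) atTop (𝓝[>] 0) := by
  rw [tendsto_nhdsWithin_iff]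
  constructor
  · have h1 : Tendsto (fun n : ℕ => A / (n : ℝ)) atTop (𝓝 0) :=
      tendsto_const_div_atTop_nhds_zero_nat A
    have h2 := h1.rpow_const (p := (1 : ℝ) / 32) (by right; norm_num)
    rw [Real.zero_rpow (by norm_num)] at h2
    exact h2
  · filter_upwards [eventually_gt_atTop 0] with n hn
    exact tbS_pos A hA n hn

theorem tauber (c : ℕ → ℝ) (F : ℂ → ℂ)
    (hF : ∀ z : ℂ, 0 < z.re → HasSum (fun n : ℕ => (c n : ℂ) * cexp (-(n * z))) (F z))
    (A l : ℝ) (hA : 0 < A) (k : ℕ)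
    (hmaj : ∀ ε > 0, ∀ᶠ s : ℝ in 𝓝[>] 0, ∀ θ : ℝ, |θ| ≤ s ^ 17 →
      ‖F ((s ^ 16 : ℝ) + θ * I) * cexp (-(A / ((s ^ 16 : ℝ) + θ * I))) / (s ^ k : ℝ) - l‖ ≤ ε)
    (hmin : ∀ ε > 0, ∀ᶠ s : ℝ in 𝓝[>] 0, ∀ θ : ℝ, s ^ 17 ≤ |θ| → |θ| ≤ π →
      ‖F ((s ^ 16 : ℝ) + θ * I)‖ ≤ ε * s ^ (24 + k) * Real.exp (A / s ^ 16)) :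
    Tendsto (fun n : ℕ => 2 * π * c n * Real.exp (-(2 * A / tbS A n ^ 16)) / tbS A n ^ (24 + k))
      atTop (𝓝 (l * √(π / A))) := by
  have hT := tbS_tendsto A hA
  have h1 : Tendsto (fun n : ℕ => (l : ℂ) * tbG A (tbS A n)) atTop
      (𝓝 (l * ((√(π / A) : ℝ) : ℂ))) := ((tbG_tendsto A hA).comp hT).const_mul _
  have h2 : Tendsto (fun n : ℕ => ((2 * π * c n * Real.exp (-(2 * A / tbS A n ^ 16)) /
      tbS A n ^ (24 + k) : ℝ) : ℂ) - l * tbG A (tbS A n)) atTop (𝓝 0) := by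
    rw [Metric.tendsto_nhds]
    intro δ hδ
    set K : ℝ := 2 * π + √(π / (A / 2)) with hK
    have hK0 : 0 < K := by positivity
    have hε : 0 < δ / (2 * K) := by positivity
    filter_upwards [hT.eventually (hmaj _ hε), hT.eventually (hmin _ hε),
      hT.eventually (Ioo_mem_nhdsGT (show (0:ℝ) < 1 by norm_num)), eventually_gt_atTop 0]
      with n hn1 hn2 hn3 hn4
    have := tb_bound c F hF A l hA k n (tbS A n) _ hn3.1 hn3.2 (tbS_pow A hA n hn4) hε hn1 hn2
    rw [dist_zero_right]
    refine this.trans_lt ?_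
    rw [← hK]
    have : δ / (2 * K) * K = δ / 2 := by field_simp
    linarith
  have h3 := h2.add h1
  simp only [sub_add_cancel, zero_add] at h3
  have h4 := (Complex.continuous_re.tendsto _).comp h3
  have e : (l * ((√(π / A) : ℝ) : ℂ)).re = l * √(π / A) := by
    rw [Complex.re_ofReal_mul, Complex.ofReal_re]
  rw [e] at h4
  exact h4

/-- Euler product `(q;q)_∞`. -/
def eu (q : ℂ) : ℂ := ∏' n : ℕ, (1 - q ^ (n + 1))

lemma eu_tendsto : Tendsto eu (𝓝 0) (𝓝 1) := by
  have h1 : ContinuousAt (fun q : ℂ => ∏' n : ℕ, (1 - q ^ (n + 1))) 0 :=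
    (ModularForm.differentiableOn_tprod_one_sub_pow.differentiableAt
      (Metric.isOpen_ball.mem_nhds (by simp))).continuousAt
  have h2 := h1.tendsto
  simp at h2
  exact h2

lemma csqrt_real_mul (r : ℝ) (hr : 0 < r) (x : ℂ) (hx : x ≠ 0) :
    Complex.sqrt (r * x) = (√r : ℝ) * Complex.sqrt x := by
  have hr' : (r : ℂ) ≠ 0 := by exact_mod_cast hr.ne'
  unfold Complex.sqrt
  rw [Complex.cpow_def_of_ne_zero (mul_ne_zero hr' hx), Complex.log_ofReal_mul hr hx, add_mul,
    Complex.exp_add, Complex.cpow_def_of_ne_zero hx, Real.sqrt_eq_rpow,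
    Complex.ofReal_cpow hr.le, Complex.cpow_def_of_ne_zero hr', Complex.ofReal_log hr.le]
  norm_num

lemma csqrt_sq (x : ℂ) : Complex.sqrt x ^ 2 = x := by
  unfold Complex.sqrt
  rw [← Complex.cpow_nat_mul]
  norm_num

lemma csqrt_I_mul (x : ℂ) (hx : 0 < x.re) :
    Complex.sqrt (I * x) = Complex.sqrt I * Complex.sqrt x := by
  have hx0 : x ≠ 0 := by
    rintro rfl
    simp at hx
  unfold Complex.sqrt
  have hlog : Complex.log (I * x) = Complex.log I + Complex.log x := by
    apply Complex.log_mul I_ne_zero hx0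
    rw [Complex.arg_I]
    have h2 := Complex.abs_arg_lt_pi_div_two_iff.mpr (Or.inl hx)
    have := abs_lt.mp h2
    constructor <;> linarith [Real.pi_pos]
  rw [Complex.cpow_def_of_ne_zero (mul_ne_zero I_ne_zero hx0), hlog, add_mul, Complex.exp_add,
    Complex.cpow_def_of_ne_zero hx0, Complex.cpow_def_of_ne_zero I_ne_zero]

lemma eu_ne_zero {q : ℂ} (hq : ‖q‖ < 1) : eu q ≠ 0 := by
  unfold eu
  simp_rw [sub_eq_add_neg]
  apply tprod_one_add_ne_zero_of_summable
  · intro n h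
    have h1 : q ^ (n + 1) = 1 := by linear_combination -h
    have h2 : ‖q‖ ^ (n + 1) < 1 := pow_lt_one₀ (norm_nonneg _) hq (by omega)
    rw [← norm_pow, h1] at h2
    simp at h2
  · simpa using (summable_nat_add_iff 1).mpr (summable_geometric_of_lt_one (norm_nonneg _) hq)

lemma eu_modular (z : ℂ) (hz : 0 < z.re) :
    eu (cexp (-z)) = cexp (z / 24 - π ^ 2 / (6 * z)) * eu (cexp (-(4 * π ^ 2 / z))) /
      Complex.sqrt (z / (2 * π)) := by
  have hz0 : z ≠ 0 := by
    rintro rfl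
    simp at hz
  have hpi : (π : ℂ) ≠ 0 := by exact_mod_cast Real.pi_ne_zero
  set x : ℂ := z / (2 * π) with hx
  have hxr : x = ((1 / (2 * π) : ℝ) : ℂ) * z := by
    rw [hx]; push_cast; field_simp
  have hxre : 0 < x.re := by
    rw [hxr, Complex.re_ofReal_mul]
    have := Real.pi_pos
    positivity
  have hx0 : x ≠ 0 := by
    intro h
    rw [h] at hxre
    simp at hxre
  have hτ : (I * x) ∈ UpperHalfPlane.upperHalfPlaneSet := by
    simp [UpperHalfPlane.upperHalfPlaneSet]
    exact hxre
  have key := ModularForm.eta_comp_eq_csqrt_I_inv hτ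
  simp only [Function.comp, Pi.smul_apply, Pi.mul_apply, smul_eq_mul] at key
  rw [csqrt_I_mul x hxre] at key
  have hsI : Complex.sqrt I ≠ 0 := by
    intro h
    have := csqrt_sq I
    rw [h] at this
    simp at this
    exact I_ne_zero this.symm
  have hsx : Complex.sqrt x ≠ 0 := by
    intro h
    have := csqrt_sq x
    rw [h] at this
    simp at this
    exact hx0 this.symm
  have e1 : ∀ n, ModularForm.eta_q n (-1 / (I * x)) = cexp (-(4 * π ^ 2 / z)) ^ (n + 1) := by
    intro n
    rw [ModularForm.eta_q_eq_pow]
    congr 2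
    rw [hx]
    field_simp
    ring_nf
  have e2 : ∀ n, ModularForm.eta_q n (I * x) = cexp (-z) ^ (n + 1) := by
    intro n
    rw [ModularForm.eta_q_eq_pow]
    congr 2
    rw [hx]
    field_simp
    linear_combination I_sq
  have e3 : Function.Periodic.qParam 24 (-1 / (I * x)) = cexp (-(π ^ 2 / (6 * z))) := by
    unfold Function.Periodic.qParam
    congr 1
    rw [hx]
    push_cast
    field_simp
    ring_nf
  have e4 : Function.Periodic.qParam 24 (I * x) = cexp (-(z / 24)) := by
    unfold Function.Periodic.qParam
    congr 1
    rw [hx]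
    push_cast
    field_simp
    linear_combination I_sq
  unfold ModularForm.eta at key
  simp_rw [e1, e2] at key
  rw [e3, e4] at key
  change _ * eu _ = _ * (_ * (_ * eu _)) at key
  have e5 : cexp (z / 24 - π ^ 2 / (6 * z)) = cexp (-(π ^ 2 / (6 * z))) * cexp (z / 24) := by
    rw [← Complex.exp_add]
    ring_nf
  have e6 : cexp (-(z / 24)) * cexp (z / 24) = 1 := by
    rw [← Complex.exp_add]; simp
  rw [eq_div_iff hsx, e5]
  have e7 : (Complex.sqrt I)⁻¹ * (Complex.sqrt I * Complex.sqrt x * (cexp (-(z / 24)) * eu (cexp (-z))))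
      = Complex.sqrt x * cexp (-(z / 24)) * eu (cexp (-z)) := by
    field_simp
  rw [e7] at key
  linear_combination (-cexp (z / 24)) * key - (eu (cexp (-z)) * Complex.sqrt x) * e6

/-- The major-arc filter. -/
def mj : Filter (ℝ × ℝ) := Filter.comap Prod.fst (𝓝[>] 0) ⊓ 𝓟 {p | |p.2| ≤ p.1 ^ 17}

lemma mj_eventually {P : ℝ × ℝ → Prop} (h : ∀ᶠ p in mj, P p) :
    ∀ᶠ s : ℝ in 𝓝[>] 0, ∀ θ : ℝ, |θ| ≤ s ^ 17 → P (s, θ) := by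
  rw [mj, Filter.eventually_inf_principal, Filter.eventually_comap] at h
  filter_upwards [h] with s hs θ hθ
  exact hs (s, θ) rfl hθ

lemma mj_fst : Tendsto Prod.fst mj (𝓝[>] (0 : ℝ)) :=
  (tendsto_comap).mono_left inf_le_left

lemma mj_mem : ∀ᶠ p in mj, |p.2| ≤ p.1 ^ 17 := by
  rw [mj, Filter.eventually_inf_principal]
  exact Eventually.of_forall fun _ h => h

/-- the point `z` -/
def zp (p : ℝ × ℝ) : ℂ := (p.1 ^ 16 : ℝ) + p.2 * I

lemma zp_re (p : ℝ × ℝ) : (zp p).re = p.1 ^ 16 := by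
  unfold zp
  simp only [Complex.add_re, Complex.ofReal_re, Complex.re_ofReal_mul, Complex.I_re, mul_zero,
      add_zero]

lemma zp_im (p : ℝ × ℝ) : (zp p).im = p.2 := by
  unfold zp
  simp only [Complex.add_im, Complex.ofReal_im, Complex.im_ofReal_mul, Complex.I_im, mul_one,
      zero_add]

lemma mj_pos : ∀ᶠ p in mj, 0 < p.1 ∧ p.1 < 1 :=
  mj_fst.eventually (Ioo_mem_nhdsGT (show (0:ℝ) < 1 by norm_num))

lemma mj_fst0 : Tendsto Prod.fst mj (𝓝 (0 : ℝ)) := mj_fst.mono_right nhdsWithin_le_nhds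

lemma mj_ratio : Tendsto (fun p => zp p / (p.1 ^ 16 : ℝ)) mj (𝓝 1) := by
  rw [tendsto_iff_norm_sub_tendsto_zero]
  refine squeeze_zero' (Eventually.of_forall fun p => norm_nonneg _) ?_ mj_fst0
  filter_upwards [mj_pos, mj_mem] with p hp hm
  have h16 : 0 < p.1 ^ 16 := by have := hp.1; positivity
  have h16c : ((p.1 ^ 16 : ℝ) : ℂ) ≠ 0 := by exact_mod_cast h16.ne'
  have : zp p / (p.1 ^ 16 : ℝ) - 1 = ((p.2 / p.1 ^ 16 : ℝ) : ℂ) * I := by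
    unfold zp
    rw [Complex.ofReal_div]
    field_simp
    ring
  rw [this, norm_mul, Complex.norm_I, mul_one, Complex.norm_real, Real.norm_eq_abs, abs_div,
    abs_of_pos h16, div_le_iff₀ h16]
  calc _ ≤ _ := hm
    _ = _ := by ring

lemma mj_zp0 : Tendsto zp mj (𝓝 0) := by
  have h1 : Tendsto (fun p : ℝ × ℝ => ((p.1 ^ 16 : ℝ) : ℂ)) mj (𝓝 0) := by
    have h0 : Tendsto (fun p : ℝ × ℝ => p.1 ^ 16) mj (𝓝 0) := by
      have := mj_fst0.pow 16
      simpa using this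
    have := (Complex.continuous_ofReal.tendsto 0).comp h0
    rw [Complex.ofReal_zero] at this
    exact this
  have h2 := mj_ratio.mul h1
  simp only [mul_zero] at h2
  refine h2.congr' ?_
  filter_upwards [mj_pos] with p hp
  have h16 : p.1 ^ 16 ≠ 0 := by have := hp.1; positivity
  have h16c : ((p.1 ^ 16 : ℝ) : ℂ) ≠ 0 := by exact_mod_cast h16
  field_simp

lemma mj_exp_inv (a : ℝ) (ha : 0 < a) : Tendsto (fun p => cexp (-(a / zp p))) mj (𝓝 0) := by
  rw [tendsto_zero_iff_norm_tendsto_zero]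
  have h1 : Tendsto (fun p : ℝ × ℝ => Real.exp (-(a / 2 / p.1 ^ 16))) mj (𝓝 0) := by
    refine Real.tendsto_exp_neg_atTop_nhds_zero.comp ?_
    have : Tendsto (fun p : ℝ × ℝ => (p.1 ^ 16)⁻¹) mj atTop := by
      apply Tendsto.inv_tendsto_nhdsGT_zero
      rw [tendsto_nhdsWithin_iff]
      constructor
      · simpa using mj_fst0.pow 16
      · filter_upwards [mj_pos] with p hp
        exact Set.mem_Ioi.mpr (pow_pos hp.1 16)
    exact this.const_mul_atTop (show 0 < a / 2 by positivity)
  refine squeeze_zero' (Eventually.of_forall fun p => norm_nonneg _) ?_ h1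
  filter_upwards [mj_pos, mj_mem] with p hp hm
  rw [Complex.norm_exp]
  apply Real.exp_le_exp.mpr
  rw [Complex.neg_re, neg_le_neg_iff, Complex.div_re]
  simp only [Complex.ofReal_re, Complex.ofReal_im, zero_mul, zero_div, add_zero,
    Complex.normSq_apply, zp_re, zp_im]
  have h16 : 0 < p.1 ^ 16 := by have := hp.1; positivity
  have h17 : p.1 ^ 17 ≤ p.1 ^ 16 := by
    have : p.1 ^ 17 = p.1 ^ 16 * p.1 := by ring
    rw [this]; nlinarith [hp.2]
  have h2 : p.2 * p.2 ≤ p.1 ^ 16 * p.1 ^ 16 := by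
    rw [← abs_mul_abs_self p.2]
    exact mul_self_le_mul_self (abs_nonneg _) (hm.trans h17)
  have h3 : 0 < p.1 ^ 16 * p.1 ^ 16 + p.2 * p.2 := by nlinarith [mul_self_nonneg p.2, mul_pos h16 h16]
  rw [div_div, div_le_div_iff₀ (by positivity) h3]
  nlinarith

/-- generating function of overpartitions -/
def Pb (z : ℂ) : ℂ := eu (cexp (-z) ^ 2) / eu (cexp (-z)) ^ 2
/-- main factor in `V` -/
def Wb (z : ℂ) : ℂ := (eu (cexp (-z) ^ 2) / eu (cexp (-z))) ^ 3

lemma eu_two (z : ℂ) (hz : 0 < z.re) :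
    eu (cexp (-z) ^ 2) = cexp (z / 12 - π ^ 2 / (12 * z)) * eu (cexp (-(2 * π ^ 2 / z))) /
      ((√2 : ℝ) * Complex.sqrt (z / (2 * π))) := by
  have hz0 : z ≠ 0 := by
    rintro rfl
    simp at hz
  have hpi : (π : ℂ) ≠ 0 := by exact_mod_cast Real.pi_ne_zero
  have h1 : cexp (-z) ^ 2 = cexp (-(2 * z)) := by
    rw [← Complex.exp_nat_mul]; congr 1; push_cast; ring
  rw [h1, eu_modular (2 * z) (by simpa using hz)]
  have h2 := csqrt_real_mul 2 (by norm_num) (z / (2 * π))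
    (div_ne_zero hz0 (mul_ne_zero two_ne_zero hpi))
  have h3 : 2 * z / (2 * π) = ((2 : ℝ) : ℂ) * (z / (2 * π)) := by push_cast; ring
  rw [h3, h2]
  have h4 : 2 * z / 24 - π ^ 2 / (6 * (2 * z)) = z / 12 - π ^ 2 / (12 * z) := by ring
  have h5 : 4 * π ^ 2 / (2 * z) = 2 * π ^ 2 / z := by field_simp; ring
  rw [h4, h5]

lemma mj_eu (a : ℝ) (ha : 0 < a) : Tendsto (fun p => eu (cexp (-(a / zp p)))) mj (𝓝 1) :=
  eu_tendsto.comp (mj_exp_inv a ha)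

lemma mj_eu4 : Tendsto (fun p => eu (cexp (-(4 * π ^ 2 / zp p)))) mj (𝓝 1) := by
  have := mj_eu (4 * π ^ 2) (by positivity)
  push_cast at this
  exact this
lemma mj_eu2 : Tendsto (fun p => eu (cexp (-(2 * π ^ 2 / zp p)))) mj (𝓝 1) := by
  have := mj_eu (2 * π ^ 2) (by positivity)
  push_cast at this
  exact this

lemma norm_exp_neg_lt (z : ℂ) (hz : 0 < z.re) : ‖cexp (-z)‖ < 1 := by
  rw [Complex.norm_exp]
  simpa using hz

lemma Wb_tendsto : Tendsto (fun p => Wb (zp p) * cexp (-(((π ^ 2 / 4 : ℝ) : ℂ) / zp p))) mj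
    (𝓝 (((1 / √2) ^ 3 : ℝ) : ℂ)) := by
  have h : Tendsto (fun p => (eu (cexp (-(2 * π ^ 2 / zp p))) / eu (cexp (-(4 * π ^ 2 / zp p)))) ^ 3 *
      (((1 / √2) ^ 3 : ℝ) : ℂ) * cexp (zp p / 8)) mj (𝓝 ((1 / 1) ^ 3 * (((1 / √2) ^ 3 : ℝ) : ℂ) * 1)) := by
    refine (((mj_eu2.div mj_eu4 one_ne_zero).pow 3).mul_const _).mul ?_
    have : Tendsto (fun z : ℂ => cexp (z / 8)) (𝓝 0) (𝓝 (cexp (0 / 8))) :=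
      (by fun_prop : Continuous (fun z : ℂ => cexp (z / 8))).tendsto 0
    simp only [zero_div, Complex.exp_zero] at this
    exact this.comp mj_zp0
  simp only [div_one, one_pow, one_mul, mul_one] at h
  refine h.congr' ?_
  filter_upwards [mj_pos] with p hp
  have hz : 0 < (zp p).re := by rw [zp_re]; have := hp.1; positivity
  set z := zp p
  have hz0 : z ≠ 0 := by
    intro h
    rw [h] at hz
    simp at hz
  have hpi : (π : ℂ) ≠ 0 := by exact_mod_cast Real.pi_ne_zero
  have hR : Complex.sqrt (z / (2 * π)) ≠ 0 := by
    intro h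
    have := csqrt_sq (z / (2 * π))
    rw [h, zero_pow two_ne_zero] at this
    exact (div_ne_zero hz0 (mul_ne_zero two_ne_zero hpi)) this.symm
  have h2 : ((√2 : ℝ) : ℂ) ≠ 0 := by
    have : √2 ≠ 0 := by positivity
    exact_mod_cast this
  have he : eu (cexp (-(4 * π ^ 2 / z))) ≠ 0 := by
    apply eu_ne_zero
    apply norm_exp_neg_lt
    rw [show (4 * π ^ 2 / z : ℂ) = ((4 * π ^ 2 : ℝ) : ℂ) / z by push_cast; rfl, Complex.div_re]
    simp only [Complex.ofReal_re, Complex.ofReal_im, zero_mul, zero_div, add_zero]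
    have := Complex.normSq_pos.mpr hz0
    have := Real.pi_pos
    positivity
  unfold Wb
  rw [eu_two z hz, eu_modular z hz]
  have e : cexp (z / 8) = (cexp (z / 12 - π ^ 2 / (12 * z)) / cexp (z / 24 - π ^ 2 / (6 * z))) ^ 3 *
      cexp (-(((π ^ 2 / 4 : ℝ) : ℂ) / z)) := by
    rw [← Complex.exp_sub, ← Complex.exp_nat_mul, ← Complex.exp_add]
    congr 1
    push_cast
    field_simp
    ring
  rw [e]
  push_cast
  field_simp

lemma Pb_tendsto : Tendsto (fun p => Pb (zp p) * cexp (-(((π ^ 2 / 4 : ℝ) : ℂ) / zp p)) /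
    (p.1 ^ 8 : ℝ)) mj (𝓝 ((1 / (2 * √π) : ℝ) : ℂ)) := by
  have h : Tendsto (fun p => (eu (cexp (-(2 * π ^ 2 / zp p))) / eu (cexp (-(4 * π ^ 2 / zp p))) ^ 2) *
      ((1 / (2 * √π) : ℝ) : ℂ) * Complex.sqrt (zp p / (p.1 ^ 16 : ℝ))) mj
      (𝓝 ((1 / 1 ^ 2) * ((1 / (2 * √π) : ℝ) : ℂ) * 1)) := by
    refine ((mj_eu2.div (mj_eu4.pow 2) (by simp)).mul_const _).mul ?_
    have : ContinuousAt Complex.sqrt 1 := by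
      unfold Complex.sqrt
      exact continuousAt_id.cpow continuousAt_const (by simp)
    have := this.tendsto
    simp only [Complex.sqrt_one] at this
    exact this.comp mj_ratio
  simp only [div_one, one_pow, one_mul, mul_one] at h
  refine h.congr' ?_
  filter_upwards [mj_pos] with p hp
  have hz : 0 < (zp p).re := by rw [zp_re]; have := hp.1; positivity
  set z := zp p
  have hz0 : z ≠ 0 := by
    intro h
    rw [h] at hz
    simp at hz
  have hpi : (π : ℂ) ≠ 0 := by exact_mod_cast Real.pi_ne_zero
  have hs : 0 < p.1 := hp.1
  have hs1 : (p.1 : ℂ) ≠ 0 := by exact_mod_cast hs.ne'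
  have hs16 : ((p.1 ^ 16 : ℝ) : ℂ) ≠ 0 := by
    have : p.1 ^ 16 ≠ 0 := by positivity
    exact_mod_cast this
  have hs8 : ((p.1 ^ 8 : ℝ) : ℂ) ≠ 0 := by
    have : p.1 ^ 8 ≠ 0 := by positivity
    exact_mod_cast this
  have hspi : ((√π : ℝ) : ℂ) ≠ 0 := by
    have : √π ≠ 0 := by have := Real.pi_pos; positivity
    exact_mod_cast this
  have hR : Complex.sqrt (z / (2 * π)) ≠ 0 := by
    intro h
    have := csqrt_sq (z / (2 * π))
    rw [h, zero_pow two_ne_zero] at this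
    exact (div_ne_zero hz0 (mul_ne_zero two_ne_zero hpi)) this.symm
  have h2 : ((√2 : ℝ) : ℂ) ≠ 0 := by
    have : √2 ≠ 0 := by positivity
    exact_mod_cast this
  have h22 : ((√2 : ℝ) : ℂ) * ((√2 : ℝ) : ℂ) = 2 := by
    rw [← Complex.ofReal_mul, Real.mul_self_sqrt (by norm_num)]; norm_num
  have he : eu (cexp (-(4 * π ^ 2 / z))) ≠ 0 := by
    apply eu_ne_zero
    apply norm_exp_neg_lt
    rw [show (4 * π ^ 2 / z : ℂ) = ((4 * π ^ 2 : ℝ) : ℂ) / z by push_cast; rfl, Complex.div_re]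
    simp only [Complex.ofReal_re, Complex.ofReal_im, zero_mul, zero_div, add_zero]
    have := Complex.normSq_pos.mpr hz0
    have := Real.pi_pos
    positivity
  have hsq : Complex.sqrt (z / (2 * π)) =
      (p.1 ^ 8 : ℝ) / ((√2 : ℝ) * (√π : ℝ)) * Complex.sqrt (z / (p.1 ^ 16 : ℝ)) := by
    have e1 : z / (2 * π) = ((p.1 ^ 16 / (2 * π) : ℝ) : ℂ) * (z / (p.1 ^ 16 : ℝ)) := by
      rw [Complex.ofReal_div]
      push_cast at hs16 ⊢
      field_simp
    rw [e1, csqrt_real_mul _ (by have := Real.pi_pos; positivity) _ (div_ne_zero hz0 hs16)]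
    congr 1
    rw [Real.sqrt_div (by positivity), show p.1 ^ 16 = (p.1 ^ 8) ^ 2 by ring,
      Real.sqrt_sq (by positivity), Real.sqrt_mul (by norm_num)]
    push_cast
    rfl
  unfold Pb
  rw [eu_two z hz, eu_modular z hz]
  have e : (1 : ℂ) = (cexp (z / 12 - π ^ 2 / (12 * z)) / cexp (z / 24 - π ^ 2 / (6 * z)) ^ 2) *
      cexp (-(((π ^ 2 / 4 : ℝ) : ℂ) / z)) := by
    rw [← Complex.exp_nat_mul, ← Complex.exp_sub, ← Complex.exp_add, ← Complex.exp_zero]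
    congr 1
    push_cast
    field_simp
    ring
  have e8 : ∀ (X Y a b g R : ℂ), X ≠ 0 → Y ≠ 0 → R ≠ 0 → b ≠ 0 →
      a * g / ((√2 : ℝ) * R) / (b * Y / R) ^ 2 = (a / b ^ 2) * (g / Y ^ 2) * (R / (√2 : ℝ)) := by
    intro X Y a b g R hX hY hR hb
    field_simp
  rw [e8 1 _ _ _ _ _ one_ne_zero he hR (Complex.exp_ne_zero _)]
  have e9 : Complex.sqrt (z / (2 * π)) / (√2 : ℝ) / (p.1 ^ 8 : ℝ) =
      ((1 / (2 * √π) : ℝ) : ℂ) * Complex.sqrt (z / (p.1 ^ 16 : ℝ)) := by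
    rw [hsq]
    push_cast
    field_simp
    linear_combination (-Complex.sqrt (z / (p.1 : ℂ) ^ 16)) * h22
  rw [mul_assoc, ← e9]
  linear_combination (eu (cexp (-(2 * π ^ 2 / z))) / eu (cexp (-(4 * π ^ 2 / z))) ^ 2 *
    (Complex.sqrt (z / (2 * π)) / (√2 : ℝ) / (p.1 ^ 8 : ℝ))) * e

/-- the coefficient of `q ^ n` in the `n`th term of `V` -/
def an (q : ℂ) (n : ℕ) : ℂ :=
  (∏ j ∈ Finset.range n, (1 + q ^ (j + 1))) ^ 2 / ∏ k ∈ Finset.range (n + 1), (1 - q ^ (2 * k + 1))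

/-- `n`th term of `V` -/
def Tn (q : ℂ) (n : ℕ) : ℂ := an q n * q ^ n

lemma one_sub_pow_ne {q : ℂ} (hq : ‖q‖ < 1) (m : ℕ) (hm : m ≠ 0) : 1 - q ^ m ≠ 0 := by
  intro h
  have h1 : q ^ m = 1 := by linear_combination -h
  have h2 : ‖q‖ ^ m < 1 := pow_lt_one₀ (norm_nonneg _) hq hm
  rw [← norm_pow, h1] at h2
  simp at h2

lemma one_add_pow_ne {q : ℂ} (hq : ‖q‖ < 1) (m : ℕ) (hm : m ≠ 0) : 1 + q ^ m ≠ 0 := by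
  intro h
  have h1 : q ^ m = -1 := by linear_combination h
  have h2 : ‖q‖ ^ m < 1 := pow_lt_one₀ (norm_nonneg _) hq hm
  rw [← norm_pow, h1] at h2
  simp at h2

lemma an_succ {q : ℂ} (n : ℕ) :
    an q (n + 1) = an q n * ((1 + q ^ (n + 1)) ^ 2 / (1 - q ^ (2 * n + 3))) := by
  unfold an
  rw [Finset.prod_range_succ, Finset.prod_range_succ _ (n + 1), mul_pow, mul_div_mul_comm]
  congr 3

lemma eu_partial {q : ℂ} (hq : ‖q‖ < 1) :
    Tendsto (fun n => ∏ j ∈ Finset.range n, (1 - q ^ (j + 1))) atTop (𝓝 (eu q)) := by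
  apply Multipliable.tendsto_prod_tprod_nat
  simp_rw [sub_eq_add_neg]
  apply multipliable_one_add_of_summable
  simpa using (summable_nat_add_iff 1).mpr (summable_geometric_of_lt_one (norm_nonneg _) hq)

lemma an_tendsto {q : ℂ} (hq : ‖q‖ < 1) :
    Tendsto (an q) atTop (𝓝 ((eu (q ^ 2) / eu q) ^ 3)) := by
  have hq2 : ‖q ^ 2‖ < 1 := by rw [norm_pow]; exact pow_lt_one₀ (norm_nonneg _) hq (by norm_num)
  have h0 := eu_ne_zero hq
  have h02 := eu_ne_zero hq2
  have h1 := eu_partial hq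
  have h2 := eu_partial hq2
  have h3 := h2.div h1 h0
  have h4 : Tendsto (fun n : ℕ => (n + 1)) atTop atTop := tendsto_add_atTop_nat 1
  have h5 : Tendsto (fun n : ℕ => 2 * (n + 1)) atTop atTop :=
    h4.const_mul_atTop' (by norm_num)
  have h6 := ((h1.comp h5).div (h2.comp h4) h02)
  have h7 := (h3.pow 2).div h6 (div_ne_zero h0 h02)
  have e : (eu (q ^ 2) / eu q) ^ 2 / (eu q / eu (q ^ 2)) = (eu (q ^ 2) / eu q) ^ 3 := by
    field_simp
  rw [e] at h7
  refine h7.congr fun n => ?_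
  simp only [Pi.div_apply, Function.comp, an]
  have hd : ∀ (r : ℂ), ‖r‖ < 1 → ∀ n, ∏ j ∈ Finset.range n, (1 - r ^ (j + 1)) ≠ 0 :=
    fun r hr n => Finset.prod_ne_zero_iff.mpr fun j _ => one_sub_pow_ne hr _ (by omega)
  congr 1
  · rw [← Finset.prod_div_distrib]
    congr 1
    apply Finset.prod_congr rfl
    intro j _
    rw [div_eq_iff (one_sub_pow_ne hq _ (by omega))]
    ring
  · rw [div_eq_iff (hd _ hq2 _)]
    generalize n + 1 = m
    induction m with
    | zero => simp
    | succ m ih =>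
      rw [show 2 * (m + 1) = 2 * m + 1 + 1 by ring, Finset.prod_range_succ, Finset.prod_range_succ, ih,
        Finset.prod_range_succ, Finset.prod_range_succ]
      ring

lemma Tn_summable {q : ℂ} (hq : ‖q‖ < 1) : Summable (fun n => ‖Tn q n‖) := by
  obtain ⟨C, hC⟩ := (an_tendsto hq).norm.bddAbove_range
  refine Summable.of_nonneg_of_le (fun n => norm_nonneg _) (fun n => ?_)
    ((summable_geometric_of_lt_one (norm_nonneg q) hq).mul_left C)
  unfold Tn
  rw [norm_mul, norm_pow]
  exact mul_le_mul_of_nonneg_right (hC ⟨n, rfl⟩) (by positivity)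

lemma an_tele {q : ℂ} (hq : ‖q‖ < 1) (hq0 : q ≠ 0) (n : ℕ) :
    (1 + q ^ (n + 1)) * an q (n + 1) - (1 + q ^ n) * an q n =
      2 * Tn q (n + 1) + (1 - 1 / q) * (Tn q (n + 1) * (1 + q ^ (n + 2)) / (1 + q ^ (n + 1)) ^ 2) := by
  unfold Tn
  rw [an_succ]
  have h1 := one_add_pow_ne hq (n + 1) (by omega)
  have h2 := one_sub_pow_ne hq (2 * n + 3) (by omega)
  field_simp
  ring

/-- generating function of `v` -/
def Vb (z : ℂ) : ℂ := ∑' n, Tn (cexp (-z)) n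

lemma V_error {q : ℂ} (hq : ‖q‖ < 1) (hq2 : 1 / 2 ≤ ‖q‖) (h1 : ∀ n, 1 / 2 ≤ ‖1 + q ^ (n + 1)‖) :
    ‖∑' n, Tn q n - (eu (q ^ 2) / eu q) ^ 3 / 2‖ ≤ 8 * ‖1 - q‖ * ∑' n, ‖Tn q n‖ := by
  have hq0 : q ≠ 0 := by
    rintro rfl
    simp at hq2
    norm_num at hq2
  set W := (eu (q ^ 2) / eu q) ^ 3
  have hs := Tn_summable hq
  have hs1 := (summable_nat_add_iff 1).mpr hs
  set b : ℕ → ℂ := fun n => Tn q (n + 1) * (1 + q ^ (n + 2)) / (1 + q ^ (n + 1)) ^ 2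
  have hb : ∀ n, ‖b n‖ ≤ 8 * ‖Tn q (n + 1)‖ := by
    intro n
    simp only [b]
    rw [norm_div, norm_mul, norm_pow]
    have h2 : ‖1 + q ^ (n + 2)‖ ≤ 2 := by
      refine (norm_add_le _ _).trans ?_
      have : ‖q ^ (n + 2)‖ ≤ 1 := by rw [norm_pow]; exact pow_le_one₀ (norm_nonneg _) hq.le
      simp only [norm_one]; linarith
    have h3 := h1 n
    rw [div_le_iff₀ (by positivity)]
    have h4 : 1 / 4 ≤ ‖1 + q ^ (n + 1)‖ ^ 2 := by nlinarith
    have h5 := norm_nonneg (Tn q (n + 1))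
    nlinarith [mul_le_mul_of_nonneg_left h2 h5, mul_le_mul_of_nonneg_left h4 h5]
  have hbs : Summable (fun n => ‖b n‖) :=
    Summable.of_nonneg_of_le (fun n => norm_nonneg _) hb (hs1.mul_left 8)
  have hlim : Tendsto (fun n => (1 + q ^ n) * an q n) atTop (𝓝 W) := by
    have := ((tendsto_pow_atTop_nhds_zero_of_norm_lt_one hq).const_add 1).mul (an_tendsto hq)
    simpa using this
  have hsum : HasSum (fun n => 2 * Tn q (n + 1) + (1 - 1 / q) * b n)
      (2 * ∑' n, Tn q (n + 1) + (1 - 1 / q) * ∑' n, b n) :=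
    (hs1.of_norm.hasSum.mul_left 2).add (hbs.of_norm.hasSum.mul_left _)
  have h3 := hsum.tendsto_sum_nat
  have h4 : ∀ N, ∑ n ∈ Finset.range N, (2 * Tn q (n + 1) + (1 - 1 / q) * b n) =
      (1 + q ^ N) * an q N - 2 * an q 0 := by
    intro N
    rw [Finset.sum_congr rfl (fun n _ => (an_tele hq hq0 n).symm),
      Finset.sum_range_sub (fun n => (1 + q ^ n) * an q n)]
    norm_num
  simp_rw [h4] at h3
  have h5 := tendsto_nhds_unique h3 (hlim.sub_const (2 * an q 0))
  have h6 : ∑' n, Tn q n = Tn q 0 + ∑' n, Tn q (n + 1) := hs.of_norm.tsum_eq_zero_add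
  have h7 : Tn q 0 = an q 0 := by simp [Tn]
  have h8 : ∑' n, Tn q n - W / 2 = -(1 / 2) * ((1 - 1 / q) * ∑' n, b n) := by
    rw [h6, h7]
    linear_combination (1 / 2 : ℂ) * h5
  rw [h8, norm_mul, norm_mul]
  have h9 : ‖∑' n, b n‖ ≤ 8 * ∑' n, ‖Tn q n‖ := by
    refine (norm_tsum_le_tsum_norm hbs).trans ?_
    refine (hbs.tsum_le_tsum hb (hs1.mul_left 8)).trans ?_
    rw [tsum_mul_left]
    have : ∑' n, ‖Tn q n‖ = ‖Tn q 0‖ + ∑' n, ‖Tn q (n + 1)‖ := hs.tsum_eq_zero_add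
    have := norm_nonneg (Tn q 0)
    linarith
  have h10 : ‖1 - 1 / q‖ ≤ 2 * ‖1 - q‖ := by
    have : 1 - 1 / q = -(1 - q) / q := by field_simp; ring
    rw [this, norm_div, norm_neg, div_le_iff₀ (by linarith)]
    nlinarith [norm_nonneg (1 - q)]
  have h11 : ‖(-(1 / 2) : ℂ)‖ = 1 / 2 := by norm_num
  rw [h11]
  have := mul_le_mul h10 h9 (norm_nonneg _) (by positivity)
  linarith

lemma an_bounds {q : ℂ} (hq : ‖q‖ < 1) (N : ℕ)
    (h1 : ∀ m ≤ 2 * N + 1, ‖q‖ ^ m / 2 ≤ (q ^ m).re) (h2 : 6 * ‖q‖ ^ (N + 1) ≤ 1 - ‖q‖) :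
    (∀ n ≥ N, ‖an q n‖ ≤ 2 * ‖(eu (q ^ 2) / eu q) ^ 3‖) ∧
    (∀ n ≤ N, ‖q‖ ^ (n + 1) * ‖an q n‖ ≤ 2 * ‖(eu (q ^ 2) / eu q) ^ 3‖ * (1 - ‖q‖)) := by
  set r := ‖q‖ with hr
  have hr0 : 0 ≤ r := norm_nonneg _
  have hr1 : 0 < 1 - r := by linarith
  have hlarge : ∀ j ≥ N, ‖an q j‖ * (1 - 3 * r ^ (j + 1)) ≤ ‖an q (j + 1)‖ := by
    intro j hj
    rw [an_succ, norm_mul]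
    apply mul_le_mul_of_nonneg_left _ (norm_nonneg _)
    have hx0 : 0 ≤ r ^ (j + 1) := by positivity
    have hx1 : r ^ (j + 1) ≤ 1 / 6 := by
      have : r ^ (j + 1) ≤ r ^ (N + 1) := pow_le_pow_of_le_one hr0 hq.le (by omega)
      linarith
    set x := r ^ (j + 1)
    have ha : 1 - x ≤ ‖1 + q ^ (j + 1)‖ := by
      have := norm_sub_norm_le (1 : ℂ) (-q ^ (j + 1))
      rw [norm_neg, norm_pow, norm_one, sub_neg_eq_add] at this
      exact this
    have hb : ‖1 - q ^ (2 * j + 3)‖ ≤ 1 + x := by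
      refine (norm_sub_le _ _).trans ?_
      rw [norm_pow, norm_one]
      have : r ^ (2 * j + 3) ≤ x := pow_le_pow_of_le_one hr0 hq.le (by omega)
      linarith
    have hc : 0 < ‖1 - q ^ (2 * j + 3)‖ := norm_pos_iff.mpr (one_sub_pow_ne hq _ (by omega))
    rw [norm_div, norm_pow, le_div_iff₀ hc]
    have hd : (1 - x) ^ 2 ≤ ‖1 + q ^ (j + 1)‖ ^ 2 := pow_le_pow_left₀ (by linarith) ha 2
    nlinarith [mul_le_mul_of_nonneg_left hb (show 0 ≤ 1 - 3 * x by linarith)]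
  have hsmall : ∀ j < N, ‖an q j‖ * (1 + r ^ (j + 1)) ≤ ‖an q (j + 1)‖ := by
    intro j hj
    rw [an_succ, norm_mul]
    apply mul_le_mul_of_nonneg_left _ (norm_nonneg _)
    have hx0 : 0 ≤ r ^ (j + 1) := by positivity
    have hx := h1 (j + 1) (by omega)
    have hy := h1 (2 * j + 3) (by omega)
    have ha : 1 + r ^ (j + 1) / 2 ≤ ‖1 + q ^ (j + 1)‖ := by
      refine le_trans ?_ (Complex.re_le_norm _)
      simp only [Complex.add_re, Complex.one_re]; linarith
    have hb : ‖1 - q ^ (2 * j + 3)‖ ≤ 1 := by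
      have hw : ‖q ^ (2 * j + 3)‖ = r ^ (2 * j + 3) := norm_pow _ _
      set w := q ^ (2 * j + 3)
      have hle : r ^ (2 * j + 3) ≤ 1 := pow_le_one₀ hr0 hq.le
      have h0 : 0 ≤ r ^ (2 * j + 3) := by positivity
      have e : ‖1 - w‖ ^ 2 = 1 - 2 * w.re + ‖w‖ ^ 2 := by
        rw [Complex.sq_norm, Complex.sq_norm, Complex.normSq_apply, Complex.normSq_apply]
        simp only [Complex.sub_re, Complex.sub_im, Complex.one_re, Complex.one_im]; ring
      rw [hw] at e
      have : ‖1 - w‖ ^ 2 ≤ 1 := by rw [e]; nlinarith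
      nlinarith [norm_nonneg (1 - w)]
    have hc : 0 < ‖1 - q ^ (2 * j + 3)‖ := norm_pos_iff.mpr (one_sub_pow_ne hq _ (by omega))
    rw [norm_div, norm_pow, le_div_iff₀ hc]
    have hd : (1 + r ^ (j + 1) / 2) ^ 2 ≤ ‖1 + q ^ (j + 1)‖ ^ 2 :=
      pow_le_pow_left₀ (by linarith) ha 2
    nlinarith [mul_le_mul_of_nonneg_left hb (show 0 ≤ 1 + r ^ (j + 1) by linarith)]
  have hA : ∀ n ≥ N, ∀ k, ‖an q n‖ * (1 - 3 * ((r ^ (n + 1) - r ^ (n + k + 1)) / (1 - r))) ≤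
      ‖an q (n + k)‖ := by
    intro n hn k
    induction k with
    | zero => simp
    | succ k ih =>
      refine le_trans ?_ (hlarge (n + k) (by omega))
      have hy : r ^ (n + k + 1) ≤ r ^ (n + 1) := pow_le_pow_of_le_one hr0 hq.le (by omega)
      have hx1 : r ^ (n + k + 1) ≤ 1 / 6 := by
        have : r ^ (n + k + 1) ≤ r ^ (N + 1) := pow_le_pow_of_le_one hr0 hq.le (by omega)
        linarith
      have hx0 : 0 ≤ r ^ (n + k + 1) := by positivity
      have e : (r ^ (n + 1) - r ^ (n + (k + 1) + 1)) / (1 - r) =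
          (r ^ (n + 1) - r ^ (n + k + 1)) / (1 - r) + r ^ (n + k + 1) := by
        field_simp
        ring
      rw [e]
      set D := (r ^ (n + 1) - r ^ (n + k + 1)) / (1 - r)
      have hD : 0 ≤ D := div_nonneg (by linarith) hr1.le
      refine le_trans ?_ (mul_le_mul_of_nonneg_right ih (by linarith))
      rw [mul_assoc]
      apply mul_le_mul_of_nonneg_left _ (norm_nonneg _)
      nlinarith [mul_nonneg hD hx0]
  have hB : ∀ n k, n + k ≤ N → ‖an q n‖ * (1 + ((r ^ (n + 1) - r ^ (n + k + 1)) / (1 - r))) ≤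
      ‖an q (n + k)‖ := by
    intro n k
    induction k with
    | zero => simp
    | succ k ih =>
      intro hk
      refine le_trans ?_ (hsmall (n + k) (by omega))
      have hy : r ^ (n + k + 1) ≤ r ^ (n + 1) := pow_le_pow_of_le_one hr0 hq.le (by omega)
      have hx0 : 0 ≤ r ^ (n + k + 1) := by positivity
      have e : (r ^ (n + 1) - r ^ (n + (k + 1) + 1)) / (1 - r) =
          (r ^ (n + 1) - r ^ (n + k + 1)) / (1 - r) + r ^ (n + k + 1) := by
        field_simp
        ring
      rw [e]
      set D := (r ^ (n + 1) - r ^ (n + k + 1)) / (1 - r)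
      have hD : 0 ≤ D := div_nonneg (by linarith) hr1.le
      refine le_trans ?_ (mul_le_mul_of_nonneg_right (ih (by omega)) (by linarith))
      rw [mul_assoc]
      apply mul_le_mul_of_nonneg_left _ (norm_nonneg _)
      nlinarith [mul_nonneg hD hx0]
  have hC : ∀ n ≥ N, ‖an q n‖ ≤ 2 * ‖(eu (q ^ 2) / eu q) ^ 3‖ := by
    intro n hn
    have hlim := ((an_tendsto hq).norm).comp (tendsto_add_atTop_nat n)
    have : ‖an q n‖ / 2 ≤ ‖(eu (q ^ 2) / eu q) ^ 3‖ := by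
      refine ge_of_tendsto' hlim fun k => ?_
      simp only [Function.comp]
      rw [add_comm k n]
      refine le_trans ?_ (hA n hn k)
      have : (r ^ (n + 1) - r ^ (n + k + 1)) / (1 - r) ≤ 1 / 6 := by
        rw [div_le_iff₀ hr1]
        have : r ^ (n + 1) ≤ r ^ (N + 1) := pow_le_pow_of_le_one hr0 hq.le (by omega)
        have : 0 ≤ r ^ (n + k + 1) := by positivity
        linarith
      nlinarith [norm_nonneg (an q n)]
    linarith
  refine ⟨hC, fun n hn => ?_⟩
  obtain ⟨k, rfl⟩ := Nat.exists_eq_add_of_le hn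
  have h3 := (hB n k le_rfl).trans (hC _ le_rfl)
  have h4 : r ^ (n + 1) / (1 - r) ≤ 1 + (r ^ (n + 1) - r ^ (n + k + 1)) / (1 - r) := by
    rw [sub_div]
    have : r ^ (n + k + 1) / (1 - r) ≤ 1 := by
      rw [div_le_iff₀ hr1]
      have : 0 ≤ r ^ (n + k + 1) := by positivity
      linarith
    linarith
  have h5 := (mul_le_mul_of_nonneg_left h4 (norm_nonneg (an q n))).trans h3
  rw [← div_le_iff₀ hr1]
  calc _ = _ := by ring
    _ ≤ _ := h5

lemma Tn_sum_le {q : ℂ} (hq : ‖q‖ < 1) (hq2 : 1 / 2 ≤ ‖q‖) (N : ℕ)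
    (h1 : ∀ m ≤ 2 * N + 1, ‖q‖ ^ m / 2 ≤ (q ^ m).re) (h2 : 6 * ‖q‖ ^ (N + 1) ≤ 1 - ‖q‖) :
    ∑' n, ‖Tn q n‖ ≤ 4 * ‖(eu (q ^ 2) / eu q) ^ 3‖ * (N * (1 - ‖q‖) + 1) := by
  obtain ⟨hA, hB⟩ := an_bounds hq N h1 h2
  set W := ‖(eu (q ^ 2) / eu q) ^ 3‖
  set r := ‖q‖ with hr
  have hW : 0 ≤ W := norm_nonneg _
  have hr1 : 0 < 1 - r := by linarith
  have hs := Tn_summable hq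
  rw [← hs.sum_add_tsum_nat_add N]
  have ha : ∑ n ∈ Finset.range N, ‖Tn q n‖ ≤ N * (4 * W * (1 - r)) := by
    have := Finset.sum_le_card_nsmul (Finset.range N) (fun n => ‖Tn q n‖) (4 * W * (1 - r)) ?_
    · simpa using this
    · intro n hn
      have := hB n (Finset.mem_range.mp hn).le
      have e : r * ‖Tn q n‖ = r ^ (n + 1) * ‖an q n‖ := by
        unfold Tn
        rw [norm_mul, norm_pow, ← hr]; ring
      rw [← e] at this
      nlinarith [norm_nonneg (Tn q n)]
  have hb : ∑' n, ‖Tn q (n + N)‖ ≤ 2 * W * (r ^ N / (1 - r)) := by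
    have hg : HasSum (fun n => 2 * W * (r ^ N * r ^ n)) (2 * W * (r ^ N * (1 - r)⁻¹)) :=
      ((hasSum_geometric_of_lt_one (norm_nonneg q) hq).mul_left _).mul_left _
    rw [div_eq_mul_inv, ← hg.tsum_eq]
    refine ((summable_nat_add_iff N).mpr hs).tsum_le_tsum (fun n => ?_) hg.summable
    unfold Tn
    rw [norm_mul, norm_pow, ← hr]
    calc _ ≤ 2 * W * r ^ (n + N) := mul_le_mul_of_nonneg_right (hA _ (by omega)) (by positivity)
      _ = _ := by ring
  have hc : r ^ N / (1 - r) ≤ 1 := by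
    rw [div_le_iff₀ hr1]
    have : r ^ (N + 1) = r ^ N * r := pow_succ _ _
    have : 0 ≤ r ^ N := by positivity
    nlinarith
  have := mul_le_mul_of_nonneg_left hc (show 0 ≤ 2 * W by linarith)
  nlinarith

lemma exp_small (c : ℝ) (hc : 0 < c) (n : ℕ) :
    Tendsto (fun s : ℝ => Real.exp (-(c / s)) / s ^ n) (𝓝[>] 0) (𝓝 0) := by
  have h1 : Tendsto (fun s : ℝ => c / s) (𝓝[>] 0) atTop := by
    simp_rw [div_eq_mul_inv]
    exact tendsto_inv_nhdsGT_zero.const_mul_atTop hc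
  have h2 := ((Real.tendsto_pow_mul_exp_neg_atTop_nhds_zero n).comp h1).const_mul (1 / c ^ n)
  rw [mul_zero] at h2
  refine h2.congr' ?_
  filter_upwards [self_mem_nhdsWithin] with s hs
  have hs : 0 < s := hs
  simp only [Function.comp]
  rw [div_pow]
  field_simp

lemma exp_small_ev (c : ℝ) (hc : 0 < c) (n : ℕ) (δ : ℝ) (hδ : 0 < δ) :
    ∀ᶠ s : ℝ in 𝓝[>] 0, Real.exp (-(c / s)) ≤ δ * s ^ n := by
  filter_upwards [self_mem_nhdsWithin, (exp_small c hc n).eventually (eventually_le_nhds hδ)]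
    with s hs h
  have hs : 0 < s := hs
  rwa [div_le_iff₀ (by positivity)] at h

lemma norm_exp_zp (p : ℝ × ℝ) : ‖cexp (-zp p)‖ = Real.exp (-p.1 ^ 16) := by
  rw [Complex.norm_exp, Complex.neg_re, zp_re]

lemma exp_pow_re (p : ℝ × ℝ) (m : ℕ) :
    (cexp (-zp p) ^ m).re = Real.exp (-p.1 ^ 16) ^ m * Real.cos (m * p.2) := by
  rw [← Complex.exp_nat_mul, Complex.exp_re, ← Real.exp_nat_mul, ← Real.cos_neg (m * p.2)]
  congr 2
  · simp [zp_re]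
  · simp [zp_im]

lemma V_major_est : ∀ᶠ p in mj, ‖Vb (zp p) - Wb (zp p) / 2‖ ≤ 256 * p.1 * ‖Wb (zp p)‖ := by
  have hsm := mj_fst.eventually (exp_small_ev (1 / 5) (by norm_num) 16 (1 / 12) (by norm_num))
  have h3 : ∀ᶠ p : ℝ × ℝ in mj, p.1 < 1 / 4 :=
    mj_fst0.eventually (eventually_lt_nhds (by norm_num))
  filter_upwards [mj_pos, mj_mem, hsm, h3] with p hp hm hsm h3
  obtain ⟨hs, hs1⟩ := hp
  have hn := norm_exp_zp p
  set q := cexp (-zp p) with hqd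
  have h16 : 0 < p.1 ^ 16 := by positivity
  have h16' : p.1 ^ 16 ≤ 1 / 4 := by
    calc p.1 ^ 16 ≤ p.1 ^ 1 := pow_le_pow_of_le_one hs.le hs1.le (by norm_num)
      _ ≤ _ := by rw [pow_one]; exact h3.le
  have h17 : p.1 ^ 17 = p.1 ^ 16 * p.1 := by ring
  have hq : ‖q‖ < 1 := by rw [hn]; simpa using h16
  have hle : 1 - p.1 ^ 16 ≤ ‖q‖ := by
    rw [hn]; have := Real.add_one_le_exp (-p.1 ^ 16); linarith
  have hq2 : 1 / 2 ≤ ‖q‖ := by linarith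
  have hr1 : p.1 ^ 16 / 2 ≤ 1 - ‖q‖ := by
    rw [hn, Real.exp_neg]
    have h1 := Real.add_one_le_exp (p.1 ^ 16)
    have h2 : (Real.exp (p.1 ^ 16))⁻¹ ≤ (p.1 ^ 16 + 1)⁻¹ := inv_anti₀ (by positivity) h1
    have h3 : (p.1 ^ 16 + 1)⁻¹ ≤ 1 - p.1 ^ 16 / 2 := by
      rw [inv_le_iff_one_le_mul₀ (by positivity)]
      nlinarith
    linarith
  set N := ⌊1 / (5 * p.1 ^ 17)⌋₊ with hN
  have hN1 : (N : ℝ) ≤ 1 / (5 * p.1 ^ 17) := Nat.floor_le (by positivity)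
  have hN2 : 1 / (5 * p.1 ^ 17) < N + 1 := Nat.lt_floor_add_one _
  have hN1' : (N : ℝ) * p.1 ^ 17 ≤ 1 / 5 := by
    rw [le_div_iff₀ (by positivity)] at hN1
    linarith
  have h1 : ∀ m ≤ 2 * N + 1, ‖q‖ ^ m / 2 ≤ (q ^ m).re := by
    intro m hmN
    rw [exp_pow_re, hn]
    have hc : |(m : ℝ) * p.2| ≤ 1 := by
      rw [abs_mul, Nat.abs_cast]
      have hm' : (m : ℝ) ≤ 2 * N + 1 := by exact_mod_cast hmN
      calc (m : ℝ) * |p.2| ≤ (2 * N + 1) * p.1 ^ 17 :=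
            mul_le_mul hm' hm (abs_nonneg _) (by positivity)
        _ ≤ 1 := by rw [h17] at *; nlinarith
    have : 1 / 2 ≤ Real.cos (m * p.2) := by
      have h4 := Real.one_sub_sq_div_two_le_cos (x := m * p.2)
      have h5 : (m * p.2) ^ 2 ≤ 1 := by rw [← sq_abs]; exact pow_le_one₀ (abs_nonneg _) hc
      linarith
    have h6 : 0 ≤ Real.exp (-p.1 ^ 16) ^ m := by positivity
    nlinarith
  have h2 : 6 * ‖q‖ ^ (N + 1) ≤ 1 - ‖q‖ := by
    have : ‖q‖ ^ (N + 1) ≤ Real.exp (-(1 / 5 / p.1)) := by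
      rw [hn, ← Real.exp_nat_mul]
      apply Real.exp_le_exp.mpr
      have e : 1 / 5 / p.1 = 1 / (5 * p.1 ^ 17) * p.1 ^ 16 := by field_simp
      rw [e]
      push_cast
      nlinarith
    linarith
  have hre : ∀ n, 1 / 2 ≤ ‖1 + q ^ (n + 1)‖ := by
    intro n
    by_cases hnN : n + 1 ≤ 2 * N + 1
    · have h5 := h1 _ hnN
      have h6 := Complex.re_le_norm (1 + q ^ (n + 1))
      rw [Complex.add_re, Complex.one_re] at h6
      have : 0 ≤ ‖q‖ ^ (n + 1) := by positivity
      linarith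
    · have h5 := norm_sub_norm_le (1 : ℂ) (-q ^ (n + 1))
      rw [norm_neg, norm_pow, norm_one, sub_neg_eq_add] at h5
      have : ‖q‖ ^ (n + 1) ≤ ‖q‖ ^ (N + 1) := pow_le_pow_of_le_one (norm_nonneg _) hq.le (by omega)
      linarith
  have hE := V_error hq hq2 hre
  have hT := Tn_sum_le hq hq2 N h1 h2
  have hz : ‖zp p‖ ≤ 2 * p.1 ^ 16 := by
    unfold zp
    refine (norm_add_le _ _).trans ?_
    rw [norm_mul, Complex.norm_I, Complex.norm_real, Complex.norm_real, Real.norm_eq_abs,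
      Real.norm_eq_abs, abs_of_pos h16]
    nlinarith
  have hq1 : ‖1 - q‖ ≤ 4 * p.1 ^ 16 := by
    rw [← norm_neg, neg_sub]
    have := Complex.norm_exp_sub_one_le (x := -zp p) (by rw [norm_neg]; linarith)
    rw [norm_neg] at this
    linarith
  have hNr : N * (1 - ‖q‖) + 1 ≤ 2 / p.1 := by
    have : N * (1 - ‖q‖) ≤ N * p.1 ^ 16 := mul_le_mul_of_nonneg_left (by linarith) (by positivity)
    have e : N * p.1 ^ 16 ≤ 1 / p.1 := by
      rw [le_div_iff₀ hs, mul_assoc, ← h17]; linarith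
    have e2 : 1 ≤ 1 / p.1 := by rw [le_div_iff₀ hs]; linarith
    have : 2 / p.1 = 1 / p.1 + 1 / p.1 := by ring
    linarith
  change ‖∑' n, Tn q n - (eu (q ^ 2) / eu q) ^ 3 / 2‖ ≤ 256 * p.1 * ‖(eu (q ^ 2) / eu q) ^ 3‖
  set W := ‖(eu (q ^ 2) / eu q) ^ 3‖
  have hW : 0 ≤ W := norm_nonneg _
  calc _ ≤ _ := hE
    _ ≤ 8 * (4 * p.1 ^ 16) * (4 * W * (2 / p.1)) := by
      refine mul_le_mul (by linarith) (hT.trans ?_) (tsum_nonneg fun _ => norm_nonneg _) (by positivity)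
      exact mul_le_mul_of_nonneg_left hNr (by positivity)
    _ = 256 * W * p.1 ^ 15 := by field_simp; ring
    _ ≤ 256 * W * p.1 ^ 1 := by
      apply mul_le_mul_of_nonneg_left _ (by positivity)
      exact pow_le_pow_of_le_one hs.le hs1.le (by norm_num)
    _ = _ := by ring

lemma V_tendsto : Tendsto (fun p => Vb (zp p) * cexp (-(((π ^ 2 / 4 : ℝ) : ℂ) / zp p))) mj
    (𝓝 (((1 / √2) ^ 3 / 2 : ℝ) : ℂ)) := by
  have h1 := Wb_tendsto
  have h2 : Tendsto (fun p => (Vb (zp p) - Wb (zp p) / 2) * cexp (-(((π ^ 2 / 4 : ℝ) : ℂ) / zp p))) mj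
      (𝓝 0) := by
    rw [tendsto_zero_iff_norm_tendsto_zero]
    have h3 : Tendsto (fun p : ℝ × ℝ => 256 * p.1 * ‖Wb (zp p) * cexp (-(((π ^ 2 / 4 : ℝ) : ℂ) / zp p))‖) mj
        (𝓝 (256 * 0 * ‖(((1 / √2) ^ 3 : ℝ) : ℂ)‖)) := (mj_fst0.const_mul 256).mul h1.norm
    rw [mul_zero, zero_mul] at h3
    refine squeeze_zero' (Eventually.of_forall fun p => norm_nonneg _) ?_ h3
    filter_upwards [V_major_est] with p hp
    rw [norm_mul, norm_mul, ← mul_assoc]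
    exact mul_le_mul_of_nonneg_right hp (norm_nonneg _)
  have h4 := h2.add (h1.mul_const (1 / 2))
  have e : (0 : ℂ) + (((1 / √2) ^ 3 : ℝ) : ℂ) * (1 / 2) = (((1 / √2) ^ 3 / 2 : ℝ) : ℂ) := by
    push_cast; ring
  rw [e] at h4
  refine h4.congr fun p => ?_
  ring

/-- ratio of the real to the complex factor -/
def kap (q : ℂ) (j : ℕ) : ℝ := ‖1 - ((‖q‖ : ℝ) : ℂ) ^ j‖ / ‖1 - q ^ j‖

lemma norm_one_sub_real {q : ℂ} (hq : ‖q‖ < 1) (j : ℕ) :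
    ‖1 - ((‖q‖ : ℝ) : ℂ) ^ j‖ = 1 - ‖q‖ ^ j := by
  have : 1 - ((‖q‖ : ℝ) : ℂ) ^ j = ((1 - ‖q‖ ^ j : ℝ) : ℂ) := by push_cast; ring
  rw [this, Complex.norm_real, Real.norm_of_nonneg]
  have := pow_le_one₀ (norm_nonneg q) hq.le (n := j)
  linarith

lemma kap_nonneg (q : ℂ) (j : ℕ) : 0 ≤ kap q j := div_nonneg (norm_nonneg _) (norm_nonneg _)

lemma kap_le_one {q : ℂ} (hq : ‖q‖ < 1) (j : ℕ) : kap q j ≤ 1 := by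
  unfold kap
  apply div_le_one_of_le₀ _ (norm_nonneg _)
  rw [norm_one_sub_real hq, ← norm_pow]
  have := norm_sub_norm_le (1 : ℂ) (q ^ j)
  simpa using this

lemma kap_mul {q : ℂ} (hq : ‖q‖ < 1) (j : ℕ) (hj : j ≠ 0) :
    ‖1 - q ^ j‖⁻¹ = kap q j * ‖1 - ((‖q‖ : ℝ) : ℂ) ^ j‖⁻¹ := by
  have h1 : ‖1 - ((‖q‖ : ℝ) : ℂ) ^ j‖ ≠ 0 :=
    norm_ne_zero_iff.mpr (one_sub_pow_ne (by simpa using hq) j hj)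
  have h2 : ‖1 - q ^ j‖ ≠ 0 := norm_ne_zero_iff.mpr (one_sub_pow_ne hq j hj)
  unfold kap
  field_simp

/-- product of the ratios -/
def Kp (q : ℂ) (J : ℕ) : ℝ := ∏ k ∈ Finset.range J, kap q (2 * k + 1)

lemma Kp_nonneg (q : ℂ) (J : ℕ) : 0 ≤ Kp q J := Finset.prod_nonneg fun _ _ => kap_nonneg _ _

lemma Kp_anti {q : ℂ} (hq : ‖q‖ < 1) {J J' : ℕ} (h : J ≤ J') : Kp q J' ≤ Kp q J := by
  have : Antitone (Kp q) := by
    apply antitone_nat_of_succ_le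
    intro n
    unfold Kp
    rw [Finset.prod_range_succ]
    exact mul_le_of_le_one_right (Kp_nonneg q n) (kap_le_one hq _)
  exact this h

lemma norm_one_add_le {q : ℂ} (j : ℕ) : ‖1 + q ^ j‖ ≤ ‖1 + ((‖q‖ : ℝ) : ℂ) ^ j‖ := by
  have : 1 + ((‖q‖ : ℝ) : ℂ) ^ j = ((1 + ‖q‖ ^ j : ℝ) : ℂ) := by push_cast; ring
  rw [this, Complex.norm_real, Real.norm_of_nonneg (by positivity)]
  refine (norm_add_le _ _).trans ?_
  rw [norm_one, norm_pow]

lemma Tn_le {q : ℂ} (hq : ‖q‖ < 1) (n : ℕ) :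
    ‖Tn q n‖ ≤ Kp q (n + 1) * ‖Tn ((‖q‖ : ℝ) : ℂ) n‖ := by
  unfold Tn an Kp
  simp only [norm_mul, norm_inv, norm_pow, norm_prod, div_eq_mul_inv, ← Finset.prod_inv_distrib]
  rw [Finset.prod_congr rfl (fun k _ => kap_mul hq (2 * k + 1) (by omega)), Finset.prod_mul_distrib]
  simp only [Complex.norm_real, norm_norm]
  set K := ∏ k ∈ Finset.range (n + 1), kap q (2 * k + 1)
  have hK : 0 ≤ K := Finset.prod_nonneg fun _ _ => kap_nonneg _ _
  set D := ∏ i ∈ Finset.range (n + 1), ‖1 - ((‖q‖ : ℝ) : ℂ) ^ (2 * i + 1)‖⁻¹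
  have hD : 0 ≤ D := Finset.prod_nonneg fun _ _ => inv_nonneg.mpr (norm_nonneg _)
  have h1 : ∏ b ∈ Finset.range n, ‖1 + q ^ (b + 1)‖ ≤
      ∏ b ∈ Finset.range n, ‖1 + ((‖q‖ : ℝ) : ℂ) ^ (b + 1)‖ :=
    Finset.prod_le_prod (fun _ _ => norm_nonneg _) (fun _ _ => norm_one_add_le _)
  have h2 := pow_le_pow_left₀ (Finset.prod_nonneg fun _ _ => norm_nonneg _) h1 2
  have h3 := mul_le_mul_of_nonneg_right h2 (show 0 ≤ K * D * ‖q‖ ^ n by positivity)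
  calc _ = _ := by ring
    _ ≤ _ := h3
    _ = _ := by ring

lemma Tn_real_norm {r : ℝ} (h0 : 0 ≤ r) (h1 : r < 1) (n : ℕ) :
    Tn (r : ℂ) n = ((‖Tn (r : ℂ) n‖ : ℝ) : ℂ) := by
  have : Tn (r : ℂ) n = (((∏ j ∈ Finset.range n, (1 + r ^ (j + 1))) ^ 2 /
      (∏ k ∈ Finset.range (n + 1), (1 - r ^ (2 * k + 1))) * r ^ n : ℝ) : ℂ) := by
    unfold Tn an
    push_cast
    rfl
  rw [this, Complex.norm_real, Real.norm_of_nonneg]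
  have : 0 ≤ ∏ k ∈ Finset.range (n + 1), (1 - r ^ (2 * k + 1)) := by
    apply Finset.prod_nonneg
    intro k _
    have := pow_le_one₀ h0 h1.le (n := 2 * k + 1)
    linarith
  positivity

lemma Tn_real_le {r : ℝ} (h0 : 0 ≤ r) (h1 : r < 1) (n : ℕ) :
    ‖Tn (r : ℂ) n‖ ≤ (4 / (1 - r)) ^ (n + 1) := by
  have hq : ‖(r : ℂ)‖ < 1 := by rw [Complex.norm_real, Real.norm_of_nonneg h0]; exact h1
  unfold Tn an
  simp only [norm_mul, norm_inv, norm_pow, norm_prod, div_eq_mul_inv, ← Finset.prod_inv_distrib]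
  rw [Complex.norm_real, Real.norm_of_nonneg h0]
  have ha : ∏ b ∈ Finset.range n, ‖1 + (r : ℂ) ^ (b + 1)‖ ≤ 2 ^ n := by
    have := Finset.prod_le_prod (s := Finset.range n) (f := fun b => ‖1 + (r : ℂ) ^ (b + 1)‖)
      (g := fun _ => 2) (fun _ _ => norm_nonneg _) ?_
    · simpa using this
    · intro b _
      refine (norm_add_le _ _).trans ?_
      have : ‖(r : ℂ) ^ (b + 1)‖ ≤ 1 := by rw [norm_pow]; exact pow_le_one₀ (norm_nonneg _) hq.le
      rw [norm_one]; linarith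
  have hb : ∏ x ∈ Finset.range (n + 1), ‖1 - (r : ℂ) ^ (2 * x + 1)‖⁻¹ ≤ ((1 - r)⁻¹) ^ (n + 1) := by
    have := Finset.prod_le_prod (s := Finset.range (n + 1))
      (f := fun x => ‖1 - (r : ℂ) ^ (2 * x + 1)‖⁻¹)
      (g := fun _ => (1 - r)⁻¹) (fun _ _ => inv_nonneg.mpr (norm_nonneg _)) ?_
    · simpa using this
    · intro b _
      apply inv_anti₀ (by linarith)
      have := norm_sub_norm_le (1 : ℂ) ((r : ℂ) ^ (2 * b + 1))
      rw [norm_one, norm_pow, Complex.norm_real, Real.norm_of_nonneg h0] at this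
      have h3 : r ^ (2 * b + 1) ≤ r ^ 1 := pow_le_pow_of_le_one h0 h1.le (by omega)
      rw [pow_one] at h3
      linarith
  have h2 := pow_le_pow_left₀ (Finset.prod_nonneg fun _ _ => norm_nonneg _) ha 2
  have hr : r ^ n ≤ 1 := pow_le_one₀ h0 h1.le
  have hi : 0 ≤ (1 - r)⁻¹ := inv_nonneg.mpr (by linarith)
  calc _ ≤ (2 ^ n) ^ 2 * ((1 - r)⁻¹) ^ (n + 1) * 1 := by
        refine mul_le_mul (mul_le_mul h2 hb ?_ (by positivity)) hr (by positivity) (by positivity)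
        exact Finset.prod_nonneg fun _ _ => inv_nonneg.mpr (norm_nonneg _)
    _ = 4 ^ n * ((1 - r)⁻¹) ^ (n + 1) := by rw [← pow_mul, mul_comm n 2, pow_mul]; norm_num
    _ ≤ 4 ^ (n + 1) * ((1 - r)⁻¹) ^ (n + 1) := by
        apply mul_le_mul_of_nonneg_right _ (by positivity)
        exact pow_le_pow_right₀ (by norm_num) (by omega)
    _ = _ := by rw [← mul_pow]

lemma V_minor {q : ℂ} (hq : ‖q‖ < 1) (J : ℕ) :
    ‖∑' n, Tn q n‖ ≤ Kp q J * ‖∑' n, Tn ((‖q‖ : ℝ) : ℂ) n‖ + J * (4 / (1 - ‖q‖)) ^ J := by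
  have hq' : ‖((‖q‖ : ℝ) : ℂ)‖ < 1 := by simpa using hq
  have hs := Tn_summable hq
  have hs' := Tn_summable hq'
  have e : ‖∑' n, Tn ((‖q‖ : ℝ) : ℂ) n‖ = ∑' n, ‖Tn ((‖q‖ : ℝ) : ℂ) n‖ := by
    rw [tsum_congr (fun n => Tn_real_norm (norm_nonneg q) hq n), ← Complex.ofReal_tsum,
      Complex.norm_real, Real.norm_of_nonneg (tsum_nonneg fun _ => norm_nonneg _)]
  rw [e]
  refine (norm_tsum_le_tsum_norm hs).trans ?_
  rw [← hs.sum_add_tsum_nat_add J, add_comm]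
  have hb4 : 1 ≤ 4 / (1 - ‖q‖) := by
    rw [le_div_iff₀ (by linarith)]; linarith [norm_nonneg q]
  apply add_le_add
  · have h1 : ∀ n, ‖Tn q (n + J)‖ ≤ Kp q J * ‖Tn ((‖q‖ : ℝ) : ℂ) (n + J)‖ := by
      intro n
      refine (Tn_le hq _).trans ?_
      exact mul_le_mul_of_nonneg_right (Kp_anti hq (by omega)) (norm_nonneg _)
    have hs2 := (summable_nat_add_iff J).mpr hs'
    refine (((summable_nat_add_iff J).mpr hs).tsum_le_tsum h1 (hs2.mul_left _)).trans ?_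
    rw [tsum_mul_left]
    apply mul_le_mul_of_nonneg_left _ (Kp_nonneg _ _)
    rw [← hs'.sum_add_tsum_nat_add J]
    have : 0 ≤ ∑ i ∈ Finset.range J, ‖Tn ((‖q‖ : ℝ) : ℂ) i‖ := Finset.sum_nonneg fun _ _ => norm_nonneg _
    linarith
  · have := Finset.sum_le_card_nsmul (Finset.range J) (fun n => ‖Tn q n‖) ((4 / (1 - ‖q‖)) ^ J) ?_
    · simpa using this
    · intro n hn
      have hn := Finset.mem_range.mp hn
      refine (Tn_le hq _).trans ?_
      have h1 : Kp q (n + 1) ≤ 1 := by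
        have := Kp_anti hq (Nat.zero_le (n + 1))
        simpa [Kp] using this
      calc _ ≤ 1 * ‖Tn ((‖q‖ : ℝ) : ℂ) n‖ := mul_le_mul_of_nonneg_right h1 (norm_nonneg _)
        _ ≤ (4 / (1 - ‖q‖)) ^ (n + 1) := by rw [one_mul]; exact Tn_real_le (norm_nonneg _) hq n
        _ ≤ _ := pow_le_pow_right₀ hb4 (by omega)

lemma Pb_partial {q : ℂ} (hq : ‖q‖ < 1) :
    Tendsto (fun n => ∏ j ∈ Finset.range n, ((1 + q ^ (j + 1)) / (1 - q ^ (j + 1)))) atTop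
      (𝓝 (eu (q ^ 2) / eu q ^ 2)) := by
  have hq2 : ‖q ^ 2‖ < 1 := by rw [norm_pow]; exact pow_lt_one₀ (norm_nonneg _) hq (by norm_num)
  have h := (eu_partial hq2).div ((eu_partial hq).pow 2) (pow_ne_zero 2 (eu_ne_zero hq))
  refine h.congr fun n => ?_
  simp only [Pi.div_apply]
  rw [← Finset.prod_pow, ← Finset.prod_div_distrib]
  apply Finset.prod_congr rfl
  intro j _
  have := one_sub_pow_ne hq (j + 1) (by omega)
  field_simp
  ring

lemma P_minor {q : ℂ} (hq : ‖q‖ < 1) (J : ℕ) :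
    ‖eu (q ^ 2) / eu q ^ 2‖ ≤ Kp q J * ‖eu (((‖q‖ : ℝ) : ℂ) ^ 2) / eu ((‖q‖ : ℝ) : ℂ) ^ 2‖ := by
  have hq' : ‖((‖q‖ : ℝ) : ℂ)‖ < 1 := by simpa using hq
  have h2 : Tendsto (fun n : ℕ => 2 * n) atTop atTop := tendsto_id.const_mul_atTop' (by norm_num)
  have hl := ((Pb_partial hq).comp h2).norm
  have hr := (((Pb_partial hq').comp h2).norm).const_mul (Kp q J)
  refine le_of_tendsto_of_tendsto hl hr ?_
  filter_upwards [eventually_ge_atTop J] with m hm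
  simp only [Function.comp]
  refine le_trans ?_ (mul_le_mul_of_nonneg_right (Kp_anti hq hm) (norm_nonneg _))
  unfold Kp
  clear hm
  induction m with
  | zero => simp
  | succ m ih =>
    rw [show 2 * (m + 1) = 2 * m + 1 + 1 by ring, Finset.prod_range_succ, Finset.prod_range_succ,
      Finset.prod_range_succ, Finset.prod_range_succ, Finset.prod_range_succ]
    simp only [norm_mul, norm_div]
    have hstep : ∀ j : ℕ, j ≠ 0 → ‖1 + q ^ j‖ / ‖1 - q ^ j‖ ≤
        kap q j * (‖1 + ((‖q‖ : ℝ) : ℂ) ^ j‖ / ‖1 - ((‖q‖ : ℝ) : ℂ) ^ j‖) := by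
      intro j hj
      rw [div_eq_mul_inv, kap_mul hq j hj]
      have := mul_le_mul_of_nonneg_right (norm_one_add_le (q := q) j)
        (show 0 ≤ kap q j * ‖1 - ((‖q‖ : ℝ) : ℂ) ^ j‖⁻¹ from
          mul_nonneg (kap_nonneg _ _) (inv_nonneg.mpr (norm_nonneg _)))
      calc _ ≤ _ := this
        _ = _ := by ring
    have s1 := hstep (2 * m + 1) (by omega)
    have s2 := hstep (2 * m + 1 + 1) (by omega)
    have s3 : ‖1 + q ^ (2 * m + 1 + 1)‖ / ‖1 - q ^ (2 * m + 1 + 1)‖ ≤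
        (‖1 + ((‖q‖ : ℝ) : ℂ) ^ (2 * m + 1 + 1)‖ / ‖1 - ((‖q‖ : ℝ) : ℂ) ^ (2 * m + 1 + 1)‖) := by
      refine s2.trans (mul_le_of_le_one_left (by positivity) (kap_le_one hq _))
    have hK : 0 ≤ ∏ k ∈ Finset.range m, kap q (2 * k + 1) :=
      Finset.prod_nonneg fun _ _ => kap_nonneg _ _
    have hk := kap_nonneg q (2 * m + 1)
    have gen : ∀ a b c x y z K k : ℝ, 0 ≤ b → 0 ≤ c → 0 ≤ x → 0 ≤ y → 0 ≤ K → 0 ≤ k →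
        a ≤ K * x → b ≤ k * y → c ≤ z → a * b * c ≤ K * k * (x * y * z) := by
      intro a b c x y z K k hb hc hx hy hK hk h1 h2 h3
      calc a * b * c ≤ K * x * (k * y) * z :=
            mul_le_mul (mul_le_mul h1 h2 hb (by positivity)) h3 hc (by positivity)
        _ = _ := by ring
    exact gen _ _ _ _ _ _ _ _ (by positivity) (by positivity) (norm_nonneg _) (by positivity)
      hK hk ih s1 s3

lemma norm_one_sub_pow_sq (p : ℝ × ℝ) (j : ℕ) :
    ‖1 - cexp (-zp p) ^ j‖ ^ 2 = (1 - Real.exp (-p.1 ^ 16) ^ j) ^ 2 +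
      4 * Real.exp (-p.1 ^ 16) ^ j * Real.sin (j * p.2 / 2) ^ 2 := by
  have hw : ‖cexp (-zp p) ^ j‖ = Real.exp (-p.1 ^ 16) ^ j := by rw [norm_pow, norm_exp_zp]
  have hre := exp_pow_re p j
  set w := cexp (-zp p) ^ j
  have e : ‖1 - w‖ ^ 2 = 1 - 2 * w.re + ‖w‖ ^ 2 := by
    rw [Complex.sq_norm, Complex.sq_norm, Complex.normSq_apply, Complex.normSq_apply]
    simp only [Complex.sub_re, Complex.sub_im, Complex.one_re, Complex.one_im]; ring
  rw [e, hw, hre]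
  have : Real.cos (j * p.2) = 1 - 2 * Real.sin (j * p.2 / 2) ^ 2 := by
    have h1 := Real.cos_two_mul (j * p.2 / 2)
    have h2 := Real.sin_sq_add_cos_sq (j * p.2 / 2)
    rw [show 2 * (j * p.2 / 2) = j * p.2 by ring] at h1
    linarith
  rw [this]
  ring

lemma sin_lower (x : ℝ) (hx : |x| ≤ π / 2) : x ^ 2 * (2 / 5) ≤ Real.sin x ^ 2 := by
  have h1 := Real.mul_abs_le_abs_sin hx
  have h2 := pow_le_pow_left₀ (by positivity) h1 2
  rw [sq_abs, mul_pow, sq_abs] at h2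
  have h3 : 2 / 5 ≤ (2 / π) ^ 2 := by
    rw [div_pow, div_le_div_iff₀ (by norm_num) (by positivity)]
    have := Real.pi_lt_d2
    have := Real.pi_pos
    nlinarith
  nlinarith [sq_nonneg x]

lemma exp_pow_ge (x : ℝ) (j : ℕ) : 1 - Real.exp (-x) ^ j ≤ j * x := by
  rw [← Real.exp_nat_mul]
  have := Real.add_one_le_exp (j * -x)
  linarith

lemma Kp_small_near : ∀ ε > 0, ∀ᶠ s : ℝ in 𝓝[>] 0, ∀ θ : ℝ, s ^ 17 ≤ |θ| → |θ| ≤ s ^ 3 →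
    Kp (cexp (-zp (s, θ))) ⌊1 / s ^ 3⌋₊ ≤ ε * s ^ 24 := by
  intro ε hε
  filter_upwards [Ioo_mem_nhdsGT (show (0:ℝ) < 1 / 4 by norm_num),
    exp_small_ev (1 / 20) (by norm_num) 48 (ε ^ 2) (by positivity)] with s hs hsm θ h1 h2
  obtain ⟨hs0, hs1⟩ := hs
  set J := ⌊1 / s ^ 3⌋₊
  have hJ1 : (J : ℝ) ≤ 1 / s ^ 3 := Nat.floor_le (by positivity)
  have hJ2 : 1 / s ^ 3 < J + 1 := Nat.lt_floor_add_one _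
  have hJs : (J : ℝ) * s ^ 3 ≤ 1 := by rwa [le_div_iff₀ (by positivity)] at hJ1
  have hq : ‖cexp (-zp (s, θ))‖ < 1 := by
    rw [norm_exp_zp]
    have : 0 < s ^ 16 := by positivity
    simpa using this
  set q := cexp (-zp (s, θ)) with hqd
  have hkap : ∀ k < J, kap q (2 * k + 1) ^ 2 ≤ Real.exp (-(s ^ 2 / 10)) := by
    intro k hk
    have hn : ‖q‖ = Real.exp (-s ^ 16) := norm_exp_zp _
    have hd := norm_one_sub_pow_sq (s, θ) (2 * k + 1)
    simp only at hd
    rw [← hqd] at hd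
    unfold kap
    rw [norm_one_sub_real hq, hn]
    set j := 2 * k + 1
    have hkJ : (k : ℝ) + 1 ≤ J := by exact_mod_cast hk
    have hjJ : (j : ℝ) ≤ 2 * J := by simp only [j]; push_cast; linarith
    have hj1 : (1 : ℝ) ≤ j := by simp only [j]; push_cast; linarith [(Nat.cast_nonneg k : (0:ℝ) ≤ k)]
    have hx : |(j : ℝ) * θ / 2| ≤ π / 2 := by
      rw [abs_div, abs_mul, Nat.abs_cast]
      have : (j : ℝ) * |θ| ≤ 2 * J * s ^ 3 := mul_le_mul hjJ h2 (abs_nonneg _) (by positivity)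
      rw [abs_two]
      have := Real.pi_gt_three
      linarith
    have hsin := sin_lower _ hx
    have hee := exp_pow_ge (s ^ 16) j
    have he0 : Real.exp (-s ^ 16) ^ j ≤ 1 := pow_le_one₀ (by positivity) (by simp; positivity)
    have hjs : (j : ℝ) * s ^ 16 ≤ 1 / 2 := by
      have e : s ^ 16 = s ^ 3 * s ^ 13 := by ring
      have e13 : s ^ 13 ≤ 1 / 4 := by
        calc s ^ 13 ≤ s ^ 1 := pow_le_pow_of_le_one hs0.le (by linarith) (by norm_num)
          _ ≤ _ := by rw [pow_one]; linarith
      calc (j : ℝ) * s ^ 16 ≤ 2 * J * s ^ 16 := mul_le_mul_of_nonneg_right hjJ (by positivity)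
        _ = 2 * (J * s ^ 3) * s ^ 13 := by ring
        _ ≤ 2 * 1 * (1 / 4) := by gcongr
        _ = _ := by norm_num
    have hr : 1 / 2 ≤ Real.exp (-s ^ 16) ^ j := by linarith
    set E := Real.exp (-s ^ 16) ^ j
    have hθ : s ^ 17 * s ^ 17 ≤ θ ^ 2 := by
      rw [← sq_abs, sq]; exact mul_self_le_mul_self (by positivity) h1
    -- main inequality
    have hmain : (1 - E) ^ 2 * (1 + s ^ 2 / 5) ≤ ‖1 - q ^ j‖ ^ 2 := by
      rw [hd]
      have a1 : (1 - E) ^ 2 ≤ (j * s ^ 16) ^ 2 := pow_le_pow_left₀ (by linarith) hee 2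
      have a2 : (j * s ^ 16) ^ 2 * s ^ 2 ≤ j ^ 2 * θ ^ 2 := by
        calc _ = (j : ℝ) ^ 2 * (s ^ 17 * s ^ 17) := by ring
          _ ≤ _ := by gcongr
      have a3 : (1 - E) ^ 2 * s ^ 2 ≤ (j * s ^ 16) ^ 2 * s ^ 2 := by gcongr
      have a4 : 2 * ((j * θ / 2) ^ 2 * (2 / 5)) ≤ 4 * E * Real.sin (j * θ / 2) ^ 2 :=
        mul_le_mul (by linarith) hsin (by positivity) (by positivity)
      nlinarith
    have hpos : 0 < ‖1 - q ^ j‖ := norm_pos_iff.mpr (one_sub_pow_ne hq _ (by omega))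
    rw [div_pow, div_le_iff₀ (by positivity)]
    have b1 := Real.add_one_le_exp (-(s ^ 2 / 10))
    have b2 : 1 ≤ (1 + s ^ 2 / 5) * (1 - s ^ 2 / 10) := by
      have : s ^ 2 ≤ 1 := pow_le_one₀ hs0.le (by linarith)
      nlinarith [sq_nonneg s]
    have b3 : 1 ≤ (1 + s ^ 2 / 5) * Real.exp (-(s ^ 2 / 10)) :=
      b2.trans (mul_le_mul_of_nonneg_left (by linarith) (by positivity))
    calc (1 - E) ^ 2 ≤ (1 - E) ^ 2 * ((1 + s ^ 2 / 5) * Real.exp (-(s ^ 2 / 10))) :=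
          le_mul_of_one_le_right (by positivity) b3
      _ = Real.exp (-(s ^ 2 / 10)) * ((1 - E) ^ 2 * (1 + s ^ 2 / 5)) := by ring
      _ ≤ _ := mul_le_mul_of_nonneg_left hmain (by positivity)
  have hK2 : Kp q J ^ 2 ≤ (ε * s ^ 24) ^ 2 := by
    unfold Kp
    rw [← Finset.prod_pow]
    have := Finset.prod_le_prod (s := Finset.range J) (f := fun k => kap q (2 * k + 1) ^ 2)
      (g := fun _ => Real.exp (-(s ^ 2 / 10))) (fun _ _ => by positivity)
      (fun k hk => hkap k (Finset.mem_range.mp hk))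
    refine this.trans ?_
    rw [Finset.prod_const, Finset.card_range, ← Real.exp_nat_mul]
    calc _ ≤ Real.exp (-(1 / 20 / s)) := by
          apply Real.exp_le_exp.mpr
          have e1 : 1 / 20 / s ≤ J * (s ^ 2 / 10) := by
            have f1 : (1 / s ^ 3 - 1) * (s ^ 2 / 10) ≤ J * (s ^ 2 / 10) := by
              gcongr; linarith
            have f2 : (1 / s ^ 3 - 1) * (s ^ 2 / 10) = 1 / 10 / s - s ^ 2 / 10 := by
              field_simp
            have f3 : s ^ 2 / 10 ≤ 1 / 20 / s := by
              rw [le_div_iff₀ hs0]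
              have : s ^ 3 ≤ 1 / 4 := by
                calc s ^ 3 ≤ s ^ 1 := pow_le_pow_of_le_one hs0.le (by linarith) (by norm_num)
                  _ ≤ _ := by rw [pow_one]; linarith
              nlinarith
            have f4 : 1 / 10 / s = 1 / 20 / s + 1 / 20 / s := by ring
            linarith
          linarith
      _ ≤ _ := hsm
      _ = _ := by ring
  exact le_of_sq_le_sq hK2 (by positivity)

lemma Kp_small_far : ∀ ε > 0, ∀ᶠ s : ℝ in 𝓝[>] 0, ∀ θ : ℝ, s ^ 3 ≤ |θ| → |θ| ≤ π →
    Kp (cexp (-zp (s, θ))) ⌊1 / s ^ 3⌋₊ ≤ ε * s ^ 24 := by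
  intro ε hε
  have h2 : Tendsto (fun s : ℝ => 135 * s ^ 2) (𝓝[>] 0) (𝓝 0) := by
    have : Tendsto (fun s : ℝ => 135 * s ^ 2) (𝓝 0) (𝓝 (135 * 0 ^ 2)) :=
      (by fun_prop : Continuous (fun s : ℝ => 135 * s ^ 2)).tendsto 0
    simp only [ne_eq, OfNat.ofNat_ne_zero, not_false_eq_true, zero_pow, mul_zero] at this
    exact this.mono_left nhdsWithin_le_nhds
  filter_upwards [Ioo_mem_nhdsGT (show (0:ℝ) < 1 / 4 by norm_num),
    h2.eventually (eventually_le_nhds hε)] with s hs hsm θ h1 h2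
  obtain ⟨hs0, hs1⟩ := hs
  have hJ : 3 ≤ ⌊1 / s ^ 3⌋₊ := by
    apply Nat.le_floor
    rw [le_div_iff₀ (by positivity)]
    have : s ^ 3 ≤ 1 / 4 := by
      calc s ^ 3 ≤ s ^ 1 := pow_le_pow_of_le_one hs0.le (by linarith) (by norm_num)
        _ ≤ _ := by rw [pow_one]; linarith
    push_cast
    linarith
  have hn : ‖cexp (-zp (s, θ))‖ = Real.exp (-s ^ 16) := norm_exp_zp _
  have hq : ‖cexp (-zp (s, θ))‖ < 1 := by
    rw [hn]
    have : 0 < s ^ 16 := by positivity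
    simpa using this
  have hd := norm_one_sub_pow_sq (s, θ) 1
  set q := cexp (-zp (s, θ)) with hqd
  simp only [pow_one, Nat.cast_one, one_mul] at hd
  have he1 := exp_pow_ge (s ^ 16) 1
  rw [pow_one] at he1
  have hs16 : s ^ 16 ≤ 1 / 2 := by
    calc s ^ 16 ≤ s ^ 1 := pow_le_pow_of_le_one hs0.le (by linarith) (by norm_num)
      _ ≤ _ := by rw [pow_one]; linarith
  have hsin := sin_lower (θ / 2) (by rw [abs_div, abs_two]; linarith)
  have hd1 : s ^ 3 / 3 ≤ ‖1 - q‖ := by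
    apply le_of_sq_le_sq _ (norm_nonneg _)
    rw [hd]
    have hθ : s ^ 3 * s ^ 3 ≤ θ ^ 2 := by
      rw [← sq_abs, sq]; exact mul_self_le_mul_self (by positivity) h1
    have a4 : 2 * ((θ / 2) ^ 2 * (2 / 5)) ≤ 4 * Real.exp (-s ^ 16) * Real.sin (θ / 2) ^ 2 :=
      mul_le_mul (by push_cast at he1; linarith) hsin (by positivity) (by positivity)
    nlinarith [sq_nonneg (1 - Real.exp (-s ^ 16))]
  refine (Kp_anti hq hJ).trans ?_
  have hexp : Kp q 3 = kap q 1 * kap q 3 * kap q 5 := by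
    simp [Kp, Finset.prod_range_succ]
  rw [hexp]
  have hk : ∀ j : ℕ, kap q j ≤ j * s ^ 16 / ‖1 - q ^ j‖ := by
    intro j
    unfold kap
    rw [norm_one_sub_real hq, hn]
    gcongr
    exact exp_pow_ge _ _
  have hid : ‖1 - q‖ ≤ 2 * ‖1 - q ^ 3‖ + ‖1 - q ^ 5‖ := by
    have e : 1 - q = (1 - q ^ 3) * (1 + q ^ 3) - q * (1 - q ^ 5) := by ring
    rw [e]
    refine (norm_sub_le _ _).trans ?_
    rw [norm_mul, norm_mul]
    have f1 : ‖1 + q ^ 3‖ ≤ 2 := by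
      refine (norm_add_le _ _).trans ?_
      have : ‖q ^ 3‖ ≤ 1 := by rw [norm_pow]; exact pow_le_one₀ (norm_nonneg _) hq.le
      rw [norm_one]; linarith
    nlinarith [norm_nonneg (1 - q ^ 3), norm_nonneg (1 - q ^ 5)]
  have hk1 := hk 1
  have hk3 := hk 3
  have hk5 := hk 5
  push_cast at hk1 hk3 hk5
  rw [pow_one, one_mul] at hk1
  have hpos : 0 < ‖1 - q‖ := lt_of_lt_of_le (by positivity) hd1
  have k1 : kap q 1 ≤ 3 * s ^ 13 := by
    refine hk1.trans ?_
    rw [div_le_iff₀ hpos]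
    calc s ^ 16 = 3 * s ^ 13 * (s ^ 3 / 3) := by ring
      _ ≤ _ := by gcongr
  have key : kap q 1 * kap q 3 * kap q 5 ≤ 3 * s ^ 13 * (45 * s ^ 13) := by
    have n1 := kap_nonneg q 1
    have n3 := kap_nonneg q 3
    have n5 := kap_nonneg q 5
    have l3 := kap_le_one hq 3
    have l5 := kap_le_one hq 5
    rw [mul_assoc]
    refine mul_le_mul k1 ?_ (by positivity) (by positivity)
    by_cases hc : ‖1 - q‖ / 3 ≤ ‖1 - q ^ 3‖
    · have : kap q 3 ≤ 27 * s ^ 13 := by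
        refine hk3.trans ?_
        have : 0 < ‖1 - q ^ 3‖ := by linarith
        rw [div_le_iff₀ this]
        have : s ^ 3 / 9 ≤ ‖1 - q ^ 3‖ := by linarith
        calc 3 * s ^ 16 = 27 * s ^ 13 * (s ^ 3 / 9) := by ring
          _ ≤ _ := by gcongr
      calc kap q 3 * kap q 5 ≤ kap q 3 * 1 := by gcongr
        _ ≤ 45 * s ^ 13 := by
          have : 0 < s ^ 13 := by positivity
          linarith
    · have hc5 : ‖1 - q‖ / 3 ≤ ‖1 - q ^ 5‖ := by
        push Not at hc
        linarith
      have : kap q 5 ≤ 45 * s ^ 13 := by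
        refine hk5.trans ?_
        have : 0 < ‖1 - q ^ 5‖ := by linarith
        rw [div_le_iff₀ this]
        have : s ^ 3 / 9 ≤ ‖1 - q ^ 5‖ := by linarith
        calc 5 * s ^ 16 = 45 * s ^ 13 * (s ^ 3 / 9) := by ring
          _ ≤ _ := by gcongr
      calc kap q 3 * kap q 5 ≤ 1 * kap q 5 := by gcongr
        _ ≤ 45 * s ^ 13 := by linarith
  refine key.trans ?_
  calc 3 * s ^ 13 * (45 * s ^ 13) = 135 * s ^ 2 * s ^ 24 := by ring
    _ ≤ _ := by gcongr

lemma Kp_small : ∀ ε > 0, ∀ᶠ s : ℝ in 𝓝[>] 0, ∀ θ : ℝ, s ^ 17 ≤ |θ| → |θ| ≤ π →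
    Kp (cexp (-zp (s, θ))) ⌊1 / s ^ 3⌋₊ ≤ ε * s ^ 24 := by
  intro ε hε
  filter_upwards [Kp_small_near ε hε, Kp_small_far ε hε] with s ha hb θ h1 h2
  by_cases h : |θ| ≤ s ^ 3
  · exact ha θ h1 h
  · exact hb θ (le_of_not_ge h) h2

lemma hmaj_of (F : ℂ → ℂ) (A l : ℝ) (k : ℕ)
    (h : Tendsto (fun p => F (zp p) * cexp (-((A : ℂ) / zp p)) / (p.1 ^ k : ℝ)) mj (𝓝 (l : ℂ))) :
    ∀ ε > 0, ∀ᶠ s : ℝ in 𝓝[>] 0, ∀ θ : ℝ, |θ| ≤ s ^ 17 →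
      ‖F ((s ^ 16 : ℝ) + θ * I) * cexp (-(A / ((s ^ 16 : ℝ) + θ * I))) / (s ^ k : ℝ) - l‖ ≤ ε := by
  intro ε hε
  have h1 := tendsto_iff_norm_sub_tendsto_zero.mp h
  exact mj_eventually (h1.eventually (eventually_le_nhds hε))

lemma real_bound (F : ℂ → ℂ) (A l : ℝ) (k : ℕ)
    (h : Tendsto (fun p => F (zp p) * cexp (-((A : ℂ) / zp p)) / (p.1 ^ k : ℝ)) mj (𝓝 (l : ℂ))) :
    ∀ᶠ s : ℝ in 𝓝[>] 0, ‖F (zp (s, 0))‖ ≤ (|l| + 1) * s ^ k * Real.exp (A / s ^ 16) := by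
  filter_upwards [hmaj_of F A l k h 1 one_pos, self_mem_nhdsWithin] with s hs hs0
  have hs0 : 0 < s := hs0
  have h1 := hs 0 (by simp; positivity)
  have h2 : ((s ^ 16 : ℝ) : ℂ) + ((0 : ℝ) : ℂ) * I = zp (s, 0) := rfl
  rw [h2] at h1
  have h3 : zp (s, 0) = ((s ^ 16 : ℝ) : ℂ) := by simp [zp]
  have h4 := norm_sub_norm_le (F (zp (s, 0)) * cexp (-(A / zp (s, 0))) / (s ^ k : ℝ)) (l : ℂ)
  rw [Complex.norm_real l, Real.norm_eq_abs] at h4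
  have h5 : ‖F (zp (s, 0)) * cexp (-(A / zp (s, 0))) / (s ^ k : ℝ)‖ =
      ‖F (zp (s, 0))‖ * Real.exp (-(A / s ^ 16)) / s ^ k := by
    rw [norm_div, norm_mul, Complex.norm_exp, Complex.norm_real, Real.norm_of_nonneg (by positivity)]
    congr 3
    rw [h3, ← Complex.ofReal_div, ← Complex.ofReal_neg, Complex.ofReal_re]
  rw [h5] at h4
  have h6 : ‖F (zp (s, 0))‖ * Real.exp (-(A / s ^ 16)) / s ^ k ≤ |l| + 1 := by linarith
  rw [div_le_iff₀ (by positivity), Real.exp_neg, ← div_eq_mul_inv, div_le_iff₀ (by positivity)] at h6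
  exact h6

lemma norm_q_real (s θ : ℝ) : ((‖cexp (-zp (s, θ))‖ : ℝ) : ℂ) = cexp (-zp (s, 0)) := by
  rw [norm_exp_zp]
  simp [zp]

lemma Pb_hmin : ∀ ε > 0, ∀ᶠ s : ℝ in 𝓝[>] 0, ∀ θ : ℝ, s ^ 17 ≤ |θ| → |θ| ≤ π →
    ‖Pb ((s ^ 16 : ℝ) + θ * I)‖ ≤ ε * s ^ (24 + 8) * Real.exp (π ^ 2 / 4 / s ^ 16) := by
  intro ε hε
  set l : ℝ := 1 / (2 * √π)
  have hM : 0 < |l| + 1 := by positivity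
  filter_upwards [Kp_small (ε / (|l| + 1)) (by positivity), real_bound Pb (π ^ 2 / 4) l 8 Pb_tendsto,
    self_mem_nhdsWithin] with s h1 h2 hs0 θ ha hb
  have hs0 : 0 < s := hs0
  have hq : ‖cexp (-zp (s, θ))‖ < 1 := by
    rw [norm_exp_zp]
    have : 0 < s ^ 16 := by positivity
    simpa using this
  have h3 := P_minor hq ⌊1 / s ^ 3⌋₊
  rw [norm_q_real] at h3
  have h4 := h1 θ ha hb
  change ‖Pb (zp (s, θ))‖ ≤ _
  refine le_trans h3 ?_
  refine le_trans (mul_le_mul h4 h2 (norm_nonneg _) (by positivity)) (le_of_eq ?_)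
  field_simp

lemma tail_small : ∀ ε > 0, ∀ᶠ s : ℝ in 𝓝[>] 0,
    (⌊1 / s ^ 3⌋₊ : ℝ) * (4 / (1 - Real.exp (-s ^ 16))) ^ ⌊1 / s ^ 3⌋₊ ≤
      ε * s ^ 24 * Real.exp (π ^ 2 / 4 / s ^ 16) := by
  intro ε hε
  filter_upwards [Ioo_mem_nhdsGT (show (0:ℝ) < 1 / 4 by norm_num),
    exp_small_ev 1 (by norm_num) 24 ε hε, exp_small_ev 1 (by norm_num) 16 (1 / 8) (by norm_num),
    exp_small_ev 1 (by norm_num) 3 1 (by norm_num)] with s hs h24 h16 h3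
  obtain ⟨hs0, hs1⟩ := hs
  set J := ⌊1 / s ^ 3⌋₊
  have hJ1 : (J : ℝ) ≤ 1 / s ^ 3 := Nat.floor_le (by positivity)
  have hs16 : s ^ 16 ≤ 1 / 2 := by
    calc s ^ 16 ≤ s ^ 1 := pow_le_pow_of_le_one hs0.le (by linarith) (by norm_num)
      _ ≤ _ := by rw [pow_one]; linarith
  have h16p : 0 < s ^ 16 := by positivity
  have hr1 : s ^ 16 / 2 ≤ 1 - Real.exp (-s ^ 16) := by
    rw [Real.exp_neg]
    have h1 := Real.add_one_le_exp (s ^ 16)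
    have h2 : (Real.exp (s ^ 16))⁻¹ ≤ (s ^ 16 + 1)⁻¹ := inv_anti₀ (by positivity) h1
    have h3 : (s ^ 16 + 1)⁻¹ ≤ 1 - s ^ 16 / 2 := by
      rw [inv_le_iff_one_le_mul₀ (by positivity)]
      nlinarith
    linarith
  have e1 : 4 / (1 - Real.exp (-s ^ 16)) ≤ Real.exp (1 / s) := by
    rw [div_le_iff₀ (by linarith)]
    rw [Real.exp_neg, inv_le_iff_one_le_mul₀ (by positivity)] at h16
    nlinarith [Real.exp_pos (1 / s)]
  have e2 : (J : ℝ) ≤ Real.exp (1 / s) := by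
    refine hJ1.trans ?_
    rw [div_le_iff₀ (by positivity)]
    rw [Real.exp_neg, inv_le_iff_one_le_mul₀ (by positivity)] at h3
    linarith
  have e3 : (4 / (1 - Real.exp (-s ^ 16))) ^ J ≤ Real.exp (1 / s ^ 4) := by
    calc _ ≤ Real.exp (1 / s) ^ J := pow_le_pow_left₀ (div_nonneg (by norm_num) (by linarith)) e1 J
      _ = Real.exp (J * (1 / s)) := by rw [Real.exp_nat_mul]
      _ ≤ _ := by
        apply Real.exp_le_exp.mpr
        calc (J : ℝ) * (1 / s) ≤ 1 / s ^ 3 * (1 / s) := by gcongr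
          _ = _ := by field_simp
  have e4 : 1 / s + 1 / s ^ 4 + 1 / s ≤ π ^ 2 / 4 / s ^ 16 := by
    have f1 : 1 / s ≤ 1 / s ^ 4 := by
      apply one_div_le_one_div_of_le (by positivity)
      calc s ^ 4 ≤ s ^ 1 := pow_le_pow_of_le_one hs0.le (by linarith) (by norm_num)
        _ = _ := pow_one s
    have f2 : 3 / s ^ 4 ≤ π ^ 2 / 4 / s ^ 16 := by
      rw [div_le_div_iff₀ (by positivity) (by positivity)]
      have g1 : s ^ 12 ≤ 1 / 4 := by
        calc s ^ 12 ≤ s ^ 1 := pow_le_pow_of_le_one hs0.le (by linarith) (by norm_num)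
          _ ≤ _ := by rw [pow_one]; linarith
      have g2 := Real.pi_gt_three
      calc 3 * s ^ 16 = 3 * s ^ 12 * s ^ 4 := by ring
        _ ≤ π ^ 2 / 4 * s ^ 4 := by gcongr; nlinarith
    have f3 : 3 / s ^ 4 = 1 / s ^ 4 + 1 / s ^ 4 + 1 / s ^ 4 := by ring
    linarith
  calc _ ≤ Real.exp (1 / s) * Real.exp (1 / s ^ 4) :=
        mul_le_mul e2 e3 (pow_nonneg (div_nonneg (by norm_num) (by linarith)) _) (by positivity)
    _ = Real.exp (-(1 / s)) * Real.exp (1 / s + 1 / s ^ 4 + 1 / s) := by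
        rw [← Real.exp_add, ← Real.exp_add]; ring_nf
    _ ≤ _ := mul_le_mul h24 (Real.exp_le_exp.mpr e4) (by positivity) (by positivity)

lemma V_tendsto' : Tendsto (fun p => Vb (zp p) * cexp (-(((π ^ 2 / 4 : ℝ) : ℂ) / zp p)) /
    (p.1 ^ 0 : ℝ)) mj (𝓝 (((1 / √2) ^ 3 / 2 : ℝ) : ℂ)) := by
  simpa using V_tendsto

lemma Vb_hmin : ∀ ε > 0, ∀ᶠ s : ℝ in 𝓝[>] 0, ∀ θ : ℝ, s ^ 17 ≤ |θ| → |θ| ≤ π →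
    ‖Vb ((s ^ 16 : ℝ) + θ * I)‖ ≤ ε * s ^ (24 + 0) * Real.exp (π ^ 2 / 4 / s ^ 16) := by
  intro ε hε
  set l : ℝ := (1 / √2) ^ 3 / 2
  have hM : 0 < |l| + 1 := by positivity
  filter_upwards [Kp_small (ε / 2 / (|l| + 1)) (by positivity),
    real_bound Vb (π ^ 2 / 4) l 0 V_tendsto', tail_small (ε / 2) (by positivity),
    self_mem_nhdsWithin] with s h1 h2 h5 hs0 θ ha hb
  have hs0 : 0 < s := hs0
  have hq : ‖cexp (-zp (s, θ))‖ < 1 := by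
    rw [norm_exp_zp]
    have : 0 < s ^ 16 := by positivity
    simpa using this
  have h3 := V_minor hq ⌊1 / s ^ 3⌋₊
  rw [norm_q_real, norm_exp_zp] at h3
  have h4 := h1 θ ha hb
  change ‖Vb (zp (s, θ))‖ ≤ _
  refine le_trans h3 ?_
  have h6 := mul_le_mul h4 h2 (norm_nonneg _) (by positivity)
  refine le_trans (add_le_add h6 h5) (le_of_eq ?_)
  field_simp
  ring

/-- relation between consecutive parts -/
def obRel (a b : ℕ) : Prop := a ≤ b ∧ (a = b → Odd a)

instance : IsTrans ℕ obRel := ⟨fun a b c h1 h2 => by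
  refine ⟨h1.1.trans h2.1, fun h => h1.2 ?_⟩
  have := h1.1; have := h2.1; omega⟩

/-- parts multiset -/
def obM (N : ℕ) (E : Finset (Fin N)) (m : Fin (N + 1) → ℕ) : Multiset ℕ :=
  ∑ k, Multiset.replicate (m k) (2 * (k : ℕ) + 1) + E.val.map (fun i : Fin N => 2 * ((i : ℕ) + 1))

/-- sorted parts list -/
def obL (N : ℕ) (E : Finset (Fin N)) (m : Fin (N + 1) → ℕ) : List ℕ := (obM N E m).sort (· ≤ ·)

lemma obL_coe (N : ℕ) (E : Finset (Fin N)) (m : Fin (N + 1) → ℕ) :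
    ((obL N E m : List ℕ) : Multiset ℕ) = obM N E m := Multiset.sort_eq _ _

lemma obM_count_odd (N : ℕ) (E : Finset (Fin N)) (m : Fin (N + 1) → ℕ) (k : Fin (N + 1)) :
    (obM N E m).count (2 * (k : ℕ) + 1) = m k := by
  unfold obM
  rw [Multiset.count_add, Multiset.count_sum']
  have h1 : Multiset.count (2 * (k : ℕ) + 1) (E.val.map (fun i : Fin N => 2 * ((i : ℕ) + 1))) = 0 := by
    rw [Multiset.count_eq_zero]
    intro h
    obtain ⟨i, _, hi⟩ := Multiset.mem_map.mp h
    omega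
  rw [h1, add_zero, Finset.sum_eq_single k]
  · simp
  · intro b _ hb
    rw [Multiset.count_replicate, if_neg]
    intro h
    exact hb (Fin.ext (by omega))
  · simp

lemma obM_mem_iff (N : ℕ) (E : Finset (Fin N)) (m : Fin (N + 1) → ℕ) (x : ℕ) :
    x ∈ obM N E m ↔ (∃ k : Fin (N + 1), m k ≠ 0 ∧ x = 2 * (k : ℕ) + 1) ∨
      (∃ i ∈ E, 2 * ((i : ℕ) + 1) = x) := by
  unfold obM
  rw [Multiset.mem_add, Multiset.mem_sum]
  simp [Multiset.mem_replicate]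

lemma obM_mem_even (N : ℕ) (E : Finset (Fin N)) (m : Fin (N + 1) → ℕ) (i : Fin N) :
    2 * ((i : ℕ) + 1) ∈ obM N E m ↔ i ∈ E := by
  rw [obM_mem_iff]
  constructor
  · rintro (⟨k, _, hk⟩ | ⟨j, hj, h⟩)
    · omega
    · have : j = i := Fin.ext (by omega)
      exact this ▸ hj
  · intro h
    exact Or.inr ⟨i, h, rfl⟩

lemma obM_count_even (N : ℕ) (E : Finset (Fin N)) (m : Fin (N + 1) → ℕ) (x : ℕ) (hx : ¬ Odd x) :
    (obM N E m).count x ≤ 1 := by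
  unfold obM
  rw [Multiset.count_add, Multiset.count_sum']
  have h1 : ∑ k, Multiset.count x (Multiset.replicate (m k) (2 * (k : ℕ) + 1)) = 0 := by
    apply Finset.sum_eq_zero
    intro k _
    rw [Multiset.count_replicate, if_neg]
    intro h
    exact hx ⟨k, h.symm⟩
  rw [h1, zero_add]
  have : (E.val.map (fun i : Fin N => 2 * ((i : ℕ) + 1))).Nodup := by
    apply Multiset.Nodup.map _ E.nodup
    intro a b h
    simp only at h
    exact Fin.ext (by omega)
  exact Multiset.nodup_iff_count_le_one.mp this x

lemma obM_sum (N : ℕ) (E : Finset (Fin N)) (m : Fin (N + 1) → ℕ) :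
    (obM N E m).sum = ∑ k, m k * (2 * (k : ℕ) + 1) + 2 * ∑ i ∈ E, ((i : ℕ) + 1) := by
  unfold obM
  rw [Multiset.sum_add, Finset.mul_sum]
  congr 1
  rw [Multiset.sum_sum]
  simp

/-- good lists -/
def obGood (p : ℕ) (L : List ℕ) : Prop :=
  (∀ x ∈ L, 0 < x) ∧ (∀ x ∈ L, x < p) ∧ L.Pairwise obRel

lemma pairwise_obRel (L : List ℕ) (h : L.Pairwise (· ≤ ·)) (h2 : ∀ x, ¬ Odd x → L.count x ≤ 1) :
    L.Pairwise obRel := by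
  induction L with
  | nil => simp
  | cons a l ih =>
    rw [List.pairwise_cons] at h ⊢
    refine ⟨fun b hb => ⟨h.1 b hb, ?_⟩, ih h.2 fun x hx => ?_⟩
    · rintro rfl
      by_contra ho
      have := h2 a ho
      rw [List.count_cons_self] at this
      have := List.count_pos_iff.mpr hb
      omega
    · have := h2 x hx
      rw [List.count_cons] at this
      omega

lemma count_of_obRel (L : List ℕ) (h : L.Pairwise obRel) (x : ℕ) (hx : ¬ Odd x) :
    L.count x ≤ 1 := by
  induction L with
  | nil => simp
  | cons a l ih =>
    rw [List.pairwise_cons] at h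
    rw [List.count_cons]
    split_ifs with hax
    · have hax : a = x := by simpa using hax
      subst hax
      have : l.count a = 0 := by
        rw [List.count_eq_zero]
        intro hm
        exact hx ((h.1 a hm).2 rfl)
      omega
    · exact ih h.2

lemma obL_good (N : ℕ) (E : Finset (Fin N)) (m : Fin (N + 1) → ℕ) :
    obGood (2 * N + 2) (obL N E m) := by
  have hmem : ∀ x ∈ obL N E m, x ∈ obM N E m := fun x hx => by
    rwa [← obL_coe, Multiset.mem_coe]
  refine ⟨fun x hx => ?_, fun x hx => ?_, ?_⟩
  · rcases (obM_mem_iff _ _ _ _).mp (hmem x hx) with ⟨k, _, hk⟩ | ⟨i, _, hi⟩ <;> omega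
  · rcases (obM_mem_iff _ _ _ _).mp (hmem x hx) with ⟨k, _, hk⟩ | ⟨i, _, hi⟩
    · have := k.2; omega
    · have := i.2; omega
  · apply pairwise_obRel
    · exact Multiset.pairwise_sort _ _
    · intro x hx
      rw [← Multiset.coe_count, obL_coe]
      exact obM_count_even N E m x hx

lemma eq_of_sorted_count (L L' : List ℕ) (h : L.Pairwise (· ≤ ·)) (h' : L'.Pairwise (· ≤ ·))
    (hc : ∀ x, L.count x = L'.count x) : L = L' := by
  have hp : L.Perm L' := List.perm_iff_count.mpr hc
  exact hp.eq_of_pairwise (fun a b _ _ h1 h2 => le_antisymm h1 h2) h h'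

lemma obL_surj (N : ℕ) (L : List ℕ) (h : obGood (2 * N + 2) L) :
    L = obL N (Finset.univ.filter fun i : Fin N => 2 * ((i : ℕ) + 1) ∈ L)
      (fun k => L.count (2 * (k : ℕ) + 1)) := by
  obtain ⟨h1, h2, h3⟩ := h
  set E := Finset.univ.filter fun i : Fin N => 2 * ((i : ℕ) + 1) ∈ L with hE
  set m : Fin (N + 1) → ℕ := fun k => L.count (2 * (k : ℕ) + 1) with hm
  have hg := obL_good N E m
  apply eq_of_sorted_count
  · exact h3.imp fun h => h.1
  · exact hg.2.2.imp fun h => h.1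
  · intro x
    by_cases ho : Odd x
    · obtain ⟨k, rfl⟩ := ho
      by_cases hk : k < N + 1
      · have := obM_count_odd N E m ⟨k, hk⟩
        rw [← obL_coe, Multiset.coe_count] at this
        simp only at this
        rw [this]
      · rw [List.count_eq_zero.mpr, List.count_eq_zero.mpr]
        · intro hh; have := hg.2.1 _ hh; omega
        · intro hh; have := h2 _ hh; omega
    · have c1 := count_of_obRel L h3 x ho
      have c2 := count_of_obRel _ hg.2.2 x ho
      have hiff : x ∈ L ↔ x ∈ obL N E m := by
        constructor
        · intro hx
          have p1 := h1 x hx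
          have p2 := h2 x hx
          obtain ⟨y, hy⟩ := Nat.not_odd_iff_even.mp ho
          have hy' : x = 2 * ((y - 1) + 1) := by omega
          have hi : y - 1 < N := by omega
          have : (⟨y - 1, hi⟩ : Fin N) ∈ E := by
            rw [hE, Finset.mem_filter]
            refine ⟨Finset.mem_univ _, ?_⟩
            simp only
            rw [← hy']; exact hx
          have := (obM_mem_even N E m _).mpr this
          rw [← obL_coe, Multiset.mem_coe] at this
          simp only at this
          rwa [← hy'] at this
        · intro hx
          have : x ∈ obM N E m := by rwa [← obL_coe, Multiset.mem_coe]
          rcases (obM_mem_iff _ _ _ _).mp this with ⟨k, _, hk⟩ | ⟨i, hi, hx⟩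
          · exact absurd ⟨k, hk⟩ ho
          · rw [hE, Finset.mem_filter] at hi
            rw [← hx]; exact hi.2
      have d1 := @List.count_pos_iff _ _ _ x L
      have d2 := @List.count_pos_iff _ _ _ x (obL N E m)
      by_cases hx : x ∈ L
      · have := d1.mpr hx
        have := d2.mpr (hiff.mp hx)
        omega
      · rw [List.count_eq_zero.mpr hx, List.count_eq_zero.mpr (fun hh => hx (hiff.mpr hh))]

lemma filter_odd_eq_iff (L L' : List ℕ) (h : L.Pairwise obRel) (h' : L'.Pairwise obRel) :
    L.filter (fun x => x % 2 == 1) = L'.filter (fun x => x % 2 == 1) ↔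
      ∀ k : ℕ, L.count (2 * k + 1) = L'.count (2 * k + 1) := by
  constructor
  · intro he k
    have := congrArg (List.count (2 * k + 1)) he
    rw [List.count_filter, List.count_filter] at this
    · exact this
    · simp
    · simp
  · intro hc
    apply eq_of_sorted_count
    · exact (h.imp fun h => h.1).filter _
    · exact (h'.imp fun h => h.1).filter _
    · intro x
      by_cases ho : x % 2 = 1
      · rw [List.count_filter (by simpa using ho), List.count_filter (by simpa using ho)]
        have := hc (x / 2)
        rwa [show 2 * (x / 2) + 1 = x by omega] at this
      · rw [List.count_eq_zero.mpr, List.count_eq_zero.mpr]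
        · intro hh
          rw [List.mem_filter] at hh
          exact ho (by simpa using hh.2)
        · intro hh
          rw [List.mem_filter] at hh
          exact ho (by simpa using hh.2)

lemma isOddBalanced_iff (L : List ℕ) (p : ℕ) (R : List ℕ) :
    IsOddBalanced L p R ↔ Even p ∧ 0 < p ∧ obGood p L ∧ obGood p R.reverse ∧
      L.filter (fun x => x % 2 == 1) = R.reverse.filter (fun x => x % 2 == 1) := by
  have h1 : L.IsChain (fun a b => a ≤ b ∧ (a = b → Odd a)) ↔ L.Pairwise obRel :=
    List.isChain_iff_pairwise (R := obRel)
  have h2 : R.IsChain (fun a b => b ≤ a ∧ (a = b → Odd a)) ↔ R.reverse.Pairwise obRel := by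
    rw [← List.isChain_iff_pairwise, List.isChain_reverse]
    apply Iff.of_eq
    congr 1
    funext a b
    unfold obRel
    apply propext
    constructor
    · rintro ⟨h1, h2⟩; exact ⟨h1, fun h => h ▸ h2 h.symm⟩
    · rintro ⟨h1, h2⟩; exact ⟨h1, fun h => h ▸ h2 h.symm⟩
  unfold IsOddBalanced obGood
  simp only [List.mem_reverse]
  rw [← h1, ← h2]
  tauto

/-- parameters -/
abbrev obP : Type := Σ N : ℕ, (Finset (Fin N) × Finset (Fin N)) × (Fin (N + 1) → ℕ)

/-- the sequence with given parameters -/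
def obF (y : obP) : List ℕ × ℕ × List ℕ :=
  (obL y.1 y.2.1.1 y.2.2, 2 * y.1 + 2, (obL y.1 y.2.1.2 y.2.2).reverse)

/-- its size -/
def obW (y : obP) : ℕ :=
  y.1 + (∑ i ∈ y.2.1.1, ((i : ℕ) + 1)) + (∑ i ∈ y.2.1.2, ((i : ℕ) + 1)) +
    ∑ k, y.2.2 k * (2 * (k : ℕ) + 1)

lemma obF_size (y : obP) : (obF y).1.sum + (obF y).2.1 + (obF y).2.2.sum = 2 * obW y + 2 := by
  simp only [obF, obW, List.sum_reverse]
  rw [← Multiset.sum_coe, ← Multiset.sum_coe, obL_coe, obL_coe, obM_sum, obM_sum]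
  ring

lemma obL_count_odd (N : ℕ) (E : Finset (Fin N)) (m : Fin (N + 1) → ℕ) (k : Fin (N + 1)) :
    (obL N E m).count (2 * (k : ℕ) + 1) = m k := by
  rw [← Multiset.coe_count, obL_coe, obM_count_odd]

lemma obL_inj (N : ℕ) (E E' : Finset (Fin N)) (m m' : Fin (N + 1) → ℕ)
    (h : obL N E m = obL N E' m') : E = E' ∧ m = m' := by
  have h1 : obM N E m = obM N E' m' := by rw [← obL_coe, ← obL_coe, h]
  constructor
  · ext i
    rw [← obM_mem_even N E m, ← obM_mem_even N E' m', h1]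
  · funext k
    rw [← obM_count_odd N E m, ← obM_count_odd N E' m', h1]

lemma obF_inj : Function.Injective obF := by
  rintro ⟨N, ⟨E1, E2⟩, m⟩ ⟨N', ⟨E1', E2'⟩, m'⟩ h
  simp only [obF, Prod.mk.injEq] at h
  obtain ⟨h1, h2, h3⟩ := h
  have : N = N' := by omega
  subst this
  obtain ⟨rfl, rfl⟩ := obL_inj _ _ _ _ _ h1
  obtain ⟨rfl, _⟩ := obL_inj _ _ _ _ _ (List.reverse_injective h3)
  rfl

lemma obF_mem (y : obP) : IsOddBalanced (obF y).1 (obF y).2.1 (obF y).2.2 := by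
  rw [isOddBalanced_iff]
  simp only [obF, List.reverse_reverse]
  refine ⟨⟨y.1 + 1, by ring⟩, by omega, obL_good _ _ _, obL_good _ _ _, ?_⟩
  rw [filter_odd_eq_iff _ _ (obL_good _ _ _).2.2 (obL_good _ _ _).2.2]
  intro k
  by_cases hk : k < y.1 + 1
  · have a1 := obL_count_odd y.1 y.2.1.1 y.2.2 ⟨k, hk⟩
    have a2 := obL_count_odd y.1 y.2.1.2 y.2.2 ⟨k, hk⟩
    exact a1.trans a2.symm
  · rw [List.count_eq_zero.mpr, List.count_eq_zero.mpr]
    · intro hh; have := (obL_good _ _ _).2.1 _ hh; omega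
    · intro hh; have := (obL_good _ _ _).2.1 _ hh; omega

lemma obF_surj (x : List ℕ × ℕ × List ℕ) (h : IsOddBalanced x.1 x.2.1 x.2.2) : ∃ y, obF y = x := by
  obtain ⟨L, p, R⟩ := x
  simp only at h
  rw [isOddBalanced_iff] at h
  obtain ⟨⟨N', hN'⟩, hp, hL, hR, hf⟩ := h
  obtain ⟨N, rfl⟩ : ∃ N, p = 2 * N + 2 := ⟨N' - 1, by omega⟩
  rw [filter_odd_eq_iff _ _ hL.2.2 hR.2.2] at hf
  have e1 := obL_surj N L hL
  have e2 := obL_surj N R.reverse hR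
  have : (fun k : Fin (N + 1) => L.count (2 * (k : ℕ) + 1)) =
      (fun k : Fin (N + 1) => R.reverse.count (2 * (k : ℕ) + 1)) := funext fun k => hf k
  refine ⟨⟨N, ⟨Finset.univ.filter fun i : Fin N => 2 * ((i : ℕ) + 1) ∈ L,
    Finset.univ.filter fun i : Fin N => 2 * ((i : ℕ) + 1) ∈ R.reverse⟩,
    fun k => L.count (2 * (k : ℕ) + 1)⟩, ?_⟩
  refine Prod.ext e1.symm (Prod.ext rfl ?_)
  change (obL N _ _).reverse = R
  rw [List.reverse_eq_iff]
  rw [← this] at e2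
  exact e2.symm

lemma oddBalancedTotal_eq (n : ℕ) : oddBalancedTotal n = Nat.card {y : obP // obW y = n} := by
  unfold oddBalancedTotal
  symm
  refine Nat.card_eq_of_bijective (fun y => ⟨obF y.1, obF_mem y.1, by rw [obF_size, y.2]⟩) ⟨?_, ?_⟩
  · intro a b h
    exact Subtype.ext (obF_inj (congrArg Subtype.val h))
  · rintro ⟨x, hx, hs⟩
    obtain ⟨y, rfl⟩ := obF_surj x hx
    refine ⟨⟨y, ?_⟩, rfl⟩
    rw [obF_size] at hs
    omega

lemma pi_geom (N : ℕ) : ∀ (x : Fin N → ℂ), (∀ i, ‖x i‖ < 1) →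
    Summable (fun m : Fin N → ℕ => ‖∏ i, x i ^ m i‖) ∧
    HasSum (fun m : Fin N → ℕ => ∏ i, x i ^ m i) (∏ i, (1 - x i)⁻¹) := by
  induction N with
  | zero =>
    intro x hx
    constructor
    · exact Summable.of_finite
    · have := hasSum_fintype (fun m : Fin 0 → ℕ => ∏ i, x i ^ m i)
      simpa using this
  | succ N ih =>
    intro x hx
    obtain ⟨s1, s2⟩ := ih (fun i => x i.succ) fun i => hx _
    have g1 : Summable (fun n : ℕ => ‖x 0 ^ n‖) := by
      simp only [norm_pow]
      exact summable_geometric_of_lt_one (norm_nonneg _) (hx 0)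
    have g2 := hasSum_geometric_of_norm_lt_one (hx 0)
    let e := Fin.consEquiv (fun _ : Fin (N + 1) => ℕ)
    have he : ∀ p : ℕ × (Fin N → ℕ), ∏ i, x i ^ (e p) i = x 0 ^ p.1 * ∏ i : Fin N, x i.succ ^ p.2 i := by
      intro p
      rw [Fin.prod_univ_succ]
      rfl
    have sm := summable_mul_of_summable_norm (f := fun n : ℕ => x 0 ^ n)
      (g := fun m : Fin N → ℕ => ∏ i : Fin N, x i.succ ^ m i) g1 s1
    constructor
    · rw [← e.summable_iff]
      refine sm.norm.congr ?_
      intro p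
      simp only [Function.comp_apply]
      rw [he]
    · rw [← e.hasSum_iff, Fin.prod_univ_succ]
      refine (HasSum.mul g2 s2 sm).congr_fun ?_
      intro p
      simp only [Function.comp_apply]
      rw [he]

lemma finset_prod_sum (N : ℕ) (q : ℂ) :
    HasSum (fun E : Finset (Fin N) => ∏ i ∈ E, q ^ ((i : ℕ) + 1)) (∏ j ∈ Finset.range N, (1 + q ^ (j + 1))) := by
  have := hasSum_fintype (fun E : Finset (Fin N) => ∏ i ∈ E, q ^ ((i : ℕ) + 1))
  rw [← Finset.powerset_univ, ← Finset.prod_one_add] at this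
  rwa [← Fin.prod_univ_eq_prod_range (fun j => 1 + q ^ (j + 1))]

lemma q_obW (q : ℂ) (N : ℕ) (c : (Finset (Fin N) × Finset (Fin N)) × (Fin (N + 1) → ℕ)) :
    q ^ obW ⟨N, c⟩ = q ^ N * (((∏ i ∈ c.1.1, q ^ ((i : ℕ) + 1)) * (∏ i ∈ c.1.2, q ^ ((i : ℕ) + 1))) *
      ∏ k : Fin (N + 1), (q ^ (2 * (k : ℕ) + 1)) ^ c.2 k) := by
  have h3 : ∏ k : Fin (N + 1), (q ^ (2 * (k : ℕ) + 1)) ^ c.2 k = q ^ ∑ k, c.2 k * (2 * (k : ℕ) + 1) := by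
    rw [← Finset.prod_pow_eq_pow_sum]
    refine Finset.prod_congr rfl fun k _ => ?_
    rw [← pow_mul, mul_comm]
  rw [h3, Finset.prod_pow_eq_pow_sum, Finset.prod_pow_eq_pow_sum, ← pow_add, ← pow_add, ← pow_add]
  congr 1
  simp only [obW]
  ring

lemma fiber_sum (q : ℂ) (hq : ‖q‖ < 1) (N : ℕ) :
    HasSum (fun c : (Finset (Fin N) × Finset (Fin N)) × (Fin (N + 1) → ℕ) => q ^ obW ⟨N, c⟩) (Tn q N) := by
  have hx : ∀ k : Fin (N + 1), ‖q ^ (2 * (k : ℕ) + 1)‖ < 1 := fun k => by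
    rw [norm_pow]; exact pow_lt_one₀ (norm_nonneg _) hq (by omega)
  obtain ⟨p1, p2⟩ := pi_geom (N + 1) (fun k => q ^ (2 * (k : ℕ) + 1)) hx
  have f1 := finset_prod_sum N q
  have f2 := f1.mul f1 Summable.of_finite
  have sm := summable_mul_of_summable_norm
    (f := fun x : Finset (Fin N) × Finset (Fin N) =>
      (∏ i ∈ x.1, q ^ ((i : ℕ) + 1)) * (∏ i ∈ x.2, q ^ ((i : ℕ) + 1)))
    (g := fun m : Fin (N + 1) → ℕ => ∏ k : Fin (N + 1), (q ^ (2 * (k : ℕ) + 1)) ^ m k)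
    Summable.of_finite p1
  have f3 := HasSum.mul f2 p2 sm
  have f4 := f3.mul_left (q ^ N)
  simp only [q_obW]
  have hT : Tn q N = q ^ N * ((∏ j ∈ Finset.range N, (1 + q ^ (j + 1))) *
      (∏ j ∈ Finset.range N, (1 + q ^ (j + 1))) * ∏ k : Fin (N + 1), (1 - q ^ (2 * (k : ℕ) + 1))⁻¹) := by
    unfold Tn an
    rw [Fin.prod_univ_eq_prod_range (fun k => (1 - q ^ (2 * k + 1))⁻¹), Finset.prod_inv_distrib]
    ring
  rw [hT]
  exact f4

lemma obP_summable (q : ℂ) (hq : ‖q‖ < 1) : Summable (fun y : obP => ‖q ^ obW y‖) := by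
  have hr : ‖((‖q‖ : ℝ) : ℂ)‖ < 1 := by simpa using hq
  have key : ∀ N, HasSum (fun c : (Finset (Fin N) × Finset (Fin N)) × (Fin (N + 1) → ℕ) =>
      ‖q ^ obW ⟨N, c⟩‖) ‖Tn ((‖q‖ : ℝ) : ℂ) N‖ := by
    intro N
    have := fiber_sum _ hr N
    rw [Tn_real_norm (norm_nonneg q) hq] at this
    rw [← Complex.hasSum_ofReal]
    refine this.congr_fun ?_
    intro c
    simp
  rw [summable_sigma_of_nonneg (fun _ => norm_nonneg _)]
  refine ⟨fun N => (key N).summable, ?_⟩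
  simp only [(key _).tsum_eq]
  exact Tn_summable hr

lemma obP_hasSum (q : ℂ) (hq : ‖q‖ < 1) : HasSum (fun y : obP => q ^ obW y) (∑' n, Tn q n) :=
  HasSum.sigma_of_hasSum (Tn_summable hq).of_norm.hasSum (fun N => fiber_sum q hq N)
    (obP_summable q hq).of_norm

lemma obW_fiber_finite (n : ℕ) : Finite {y : obP // obW y = n} := by
  by_contra h
  rw [not_finite_iff_infinite] at h
  have h1 := (obP_summable (1 / 2) (by norm_num)).comp_injective
    (Subtype.val_injective (p := fun y : obP => obW y = n))
  have h2 : Summable (fun _ : {y : obP // obW y = n} => ‖((1 : ℂ) / 2) ^ n‖) :=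
    h1.congr fun y => by simp only [Function.comp_apply, y.2]
  rw [summable_const_iff] at h2
  simp at h2

lemma Vb_hasSum (z : ℂ) (hz : 0 < z.re) :
    HasSum (fun n : ℕ => (((oddBalancedTotal n : ℕ) : ℝ) : ℂ) * cexp (-(n * z))) (Vb z) := by
  have h := obP_hasSum _ (norm_exp_neg_lt z hz)
  rw [← (Equiv.sigmaFiberEquiv obW).hasSum_iff] at h
  refine HasSum.sigma h fun n => ?_
  haveI := obW_fiber_finite n
  haveI := Fintype.ofFinite {y : obP // obW y = n}
  have h2 := hasSum_fintype (fun _ : {y : obP // obW y = n} => cexp (-(n * z)))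
  rw [Finset.sum_const, Finset.card_univ, ← Nat.card_eq_fintype_card, ← oddBalancedTotal_eq, nsmul_eq_mul] at h2
  push_cast
  refine h2.congr_fun fun y => ?_
  simp only [Function.comp_apply, Equiv.sigmaFiberEquiv_apply]
  rw [y.2, ← Complex.exp_nat_mul]
  congr 1
  ring

section genfun
open PowerSeries
open scoped PowerSeries.WithPiTopology

/-- nonnegative part of a factor of the overpartition generating function -/
def ovH (i : ℕ) : PowerSeries ℝ := ∑' j : ℕ, (2 : ℝ) • (X : PowerSeries ℝ) ^ ((i + 1) * (j + 1))

/-- partial products -/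
def ovG (m : ℕ) : PowerSeries ℝ := ∏ i ∈ Finset.range m, (1 + ovH i)

lemma ovH_coeff (i n : ℕ) : (ovH i).coeff n = if n ≠ 0 ∧ (i + 1) ∣ n then 2 else 0 := by
  unfold ovH
  rw [(Nat.Partition.summable_genFun_term (fun _ _ => (2 : ℝ)) i).map_tsum _
    (WithPiTopology.continuous_coeff _ _)]
  simp only [map_smul, coeff_X_pow, smul_eq_mul, mul_ite, mul_one, mul_zero]
  split_ifs with h
  · obtain ⟨h0, k, rfl⟩ := h
    have hk : k ≠ 0 := fun h => h0 (by simp [h])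
    rw [tsum_eq_single (k - 1)]
    · rw [if_pos]
      congr 1; omega
    · intro b hb
      rw [if_neg]
      intro h
      have := Nat.eq_of_mul_eq_mul_left (Nat.succ_pos i) h
      omega
  · refine (tsum_congr fun j => ?_).trans tsum_zero
    rw [if_neg]
    rintro rfl
    exact h ⟨by positivity, dvd_mul_right _ _⟩

lemma ovF_coeff_mul (i k : ℕ) : (1 + ovH i).coeff ((i + 1) * k) = 2 - if k = 0 then 1 else 0 := by
  rw [map_add, ovH_coeff, coeff_one]
  by_cases h : k = 0
  · simp [h]; norm_num
  · simp [h]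

lemma ovF_coeff_ne (i n : ℕ) (h : ¬ (i + 1) ∣ n) : (1 + ovH i).coeff n = 0 := by
  rw [map_add, ovH_coeff, coeff_one]
  have : n ≠ 0 := by rintro rfl; exact h (dvd_zero _)
  simp [h, this]

lemma ovH_nonneg (i n : ℕ) : 0 ≤ (ovH i).coeff n := by
  rw [ovH_coeff]; split_ifs <;> norm_num

lemma coeff_mul_nonneg' (f g : PowerSeries ℝ) (hf : ∀ n, 0 ≤ f.coeff n) (hg : ∀ n, 0 ≤ g.coeff n) (n : ℕ) :
    0 ≤ (f * g).coeff n := by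
  rw [coeff_mul]
  exact Finset.sum_nonneg fun p _ => mul_nonneg (hf _) (hg _)

lemma ovG_nonneg (m : ℕ) : ∀ n, 0 ≤ (ovG m).coeff n := by
  induction m with
  | zero => intro n; simp [ovG, coeff_one]; split_ifs <;> norm_num
  | succ m ih =>
    intro n
    unfold ovG
    rw [Finset.prod_range_succ, mul_add, mul_one, map_add]
    exact add_nonneg (ih n) (coeff_mul_nonneg' _ _ ih (ovH_nonneg m) n)

lemma ovG_mono (n : ℕ) : Monotone (fun m => (ovG m).coeff n) := by
  refine monotone_nat_of_le_succ fun m => ?_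
  have : ovG (m + 1) = ovG m + ovG m * ovH m := by
    unfold ovG
    rw [Finset.prod_range_succ, mul_add, mul_one]
  rw [this, map_add]
  have := coeff_mul_nonneg' _ _ (ovG_nonneg m) (ovH_nonneg m) n
  linarith

lemma ovG_tendsto (n : ℕ) : Tendsto (fun m => (ovG m).coeff n) atTop (𝓝 (overpartition n : ℝ)) := by
  have h := (Nat.Partition.hasProd_genFun (fun _ _ => (2 : ℝ))).tendsto_prod_nat
  rw [WithPiTopology.tendsto_iff_coeff_tendsto] at h
  have h1 := h n
  rw [Nat.Partition.coeff_genFun] at h1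
  have e : ∑ p : n.Partition, p.parts.toFinsupp.prod (fun _ _ => (2 : ℝ)) = (overpartition n : ℝ) := by
    unfold overpartition
    push_cast
    refine Finset.sum_congr rfl fun p _ => ?_
    rw [Finsupp.prod, Finset.prod_const, Multiset.toFinsupp_support]
  rw [e] at h1
  exact h1

lemma ovG_le (m n : ℕ) : (ovG m).coeff n ≤ overpartition n :=
  (ovG_mono n).ge_of_tendsto (ovG_tendsto n) m

lemma ovF_sum (i : ℕ) (q : ℂ) (hq : ‖q‖ < 1) :
    Summable (fun n => ‖(((1 + ovH i).coeff n : ℝ) : ℂ) * q ^ n‖) ∧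
    HasSum (fun n => (((1 + ovH i).coeff n : ℝ) : ℂ) * q ^ n) ((1 + q ^ (i + 1)) / (1 - q ^ (i + 1))) := by
  have hx : ‖q ^ (i + 1)‖ < 1 := by
    rw [norm_pow]; exact pow_lt_one₀ (norm_nonneg _) hq (by omega)
  have hinj : Function.Injective (fun k : ℕ => (i + 1) * k) := fun a b h =>
    Nat.eq_of_mul_eq_mul_left (Nat.succ_pos i) h
  have hnr : ∀ n, n ∉ Set.range (fun k : ℕ => (i + 1) * k) → (((1 + ovH i).coeff n : ℝ) : ℂ) * q ^ n = 0 := by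
    intro n hn
    rw [ovF_coeff_ne, Complex.ofReal_zero, zero_mul]
    rintro ⟨k, rfl⟩
    exact hn ⟨k, rfl⟩
  have h1 : HasSum (fun k : ℕ => (((1 + ovH i).coeff ((i + 1) * k) : ℝ) : ℂ) * q ^ ((i + 1) * k))
      ((1 + q ^ (i + 1)) / (1 - q ^ (i + 1))) := by
    have g1 := (hasSum_geometric_of_norm_lt_one hx).mul_left 2
    have g2 := g1.sub (hasSum_ite_eq (0 : ℕ) (1 : ℂ))
    have e : (2 : ℂ) * (1 - q ^ (i + 1))⁻¹ - 1 = (1 + q ^ (i + 1)) / (1 - q ^ (i + 1)) := by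
      have := one_sub_pow_ne hq (i + 1) (by omega)
      field_simp
      ring
    rw [e] at g2
    refine g2.congr_fun fun k => ?_
    rw [ovF_coeff_mul, ← pow_mul]
    by_cases hk : k = 0
    · simp [hk]
    · simp [hk]
  have h2 := (Function.Injective.hasSum_iff (f := fun n => (((1 + ovH i).coeff n : ℝ) : ℂ) * q ^ n) hinj hnr).mp h1
  exact ⟨h2.summable.norm, h2⟩

lemma ps_mul (f g : PowerSeries ℝ) (q a b : ℂ)
    (hf : Summable (fun n => ‖((f.coeff n : ℝ) : ℂ) * q ^ n‖) ∧ HasSum (fun n => ((f.coeff n : ℝ) : ℂ) * q ^ n) a)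
    (hg : Summable (fun n => ‖((g.coeff n : ℝ) : ℂ) * q ^ n‖) ∧ HasSum (fun n => ((g.coeff n : ℝ) : ℂ) * q ^ n) b) :
    Summable (fun n => ‖(((f * g).coeff n : ℝ) : ℂ) * q ^ n‖) ∧
      HasSum (fun n => (((f * g).coeff n : ℝ) : ℂ) * q ^ n) (a * b) := by
  have e : ∀ n, (((f * g).coeff n : ℝ) : ℂ) * q ^ n =
      ∑ kl ∈ Finset.HasAntidiagonal.antidiagonal n, (((f.coeff kl.1 : ℝ) : ℂ) * q ^ kl.1) * (((g.coeff kl.2 : ℝ) : ℂ) * q ^ kl.2) := by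
    intro n
    rw [coeff_mul]
    push_cast
    rw [Finset.sum_mul]
    refine Finset.sum_congr rfl fun p hp => ?_
    rw [← Finset.HasAntidiagonal.mem_antidiagonal.mp hp, pow_add]
    ring
  have s := summable_norm_sum_mul_antidiagonal_of_summable_norm hf.1 hg.1
  have t := tsum_mul_tsum_eq_tsum_sum_antidiagonal_of_summable_norm hf.1 hg.1
  simp only [e]
  refine ⟨s, ?_⟩
  rw [hf.2.tsum_eq, hg.2.tsum_eq] at t
  rw [t]
  exact s.of_norm.hasSum

lemma ovG_sum (q : ℂ) (hq : ‖q‖ < 1) (m : ℕ) :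
    Summable (fun n => ‖(((ovG m).coeff n : ℝ) : ℂ) * q ^ n‖) ∧
    HasSum (fun n => (((ovG m).coeff n : ℝ) : ℂ) * q ^ n)
      (∏ j ∈ Finset.range m, ((1 + q ^ (j + 1)) / (1 - q ^ (j + 1)))) := by
  induction m with
  | zero =>
    have h : HasSum (fun n => (((ovG 0).coeff n : ℝ) : ℂ) * q ^ n) 1 := by
      refine (hasSum_ite_eq (0 : ℕ) (1 : ℂ)).congr_fun fun n => ?_
      simp only [ovG, Finset.range_zero, Finset.prod_empty, coeff_one]
      split_ifs with h <;> simp [h]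
    refine ⟨h.summable.norm, by simpa using h⟩
  | succ m ih =>
    have := ps_mul _ _ _ _ _ ih (ovF_sum m q hq)
    rw [Finset.prod_range_succ]
    have e : ovG (m + 1) = ovG m * (1 + ovH m) := by unfold ovG; rw [Finset.prod_range_succ]
    rw [e]
    exact this

lemma ov_summable (r : ℝ) (h0 : 0 ≤ r) (h1 : r < 1) : Summable (fun n => (overpartition n : ℝ) * r ^ n) := by
  have hr : ‖(r : ℂ)‖ < 1 := by
    rw [Complex.norm_real, Real.norm_of_nonneg h0]; exact h1
  have lim := (Pb_partial hr).norm
  refine summable_of_sum_le (c := ‖eu ((r : ℂ) ^ 2) / eu (r : ℂ) ^ 2‖) (fun n => by positivity) fun u => ?_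
  have l2 : Tendsto (fun m => ∑ n ∈ u, (ovG m).coeff n * r ^ n) atTop
      (𝓝 (∑ n ∈ u, (overpartition n : ℝ) * r ^ n)) :=
    tendsto_finsetSum _ fun n _ => (ovG_tendsto n).mul_const _
  refine le_of_tendsto_of_tendsto' l2 lim fun m => ?_
  obtain ⟨_, s⟩ := ovG_sum (r : ℂ) hr m
  have s' : HasSum (fun n => (((ovG m).coeff n * r ^ n : ℝ) : ℂ))
      (∏ j ∈ Finset.range m, ((1 + (r : ℂ) ^ (j + 1)) / (1 - (r : ℂ) ^ (j + 1)))) := by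
    refine s.congr_fun fun n => ?_
    push_cast
    rfl
  have sr : Summable (fun n => (ovG m).coeff n * r ^ n) := Complex.summable_ofReal.mp s'.summable
  have e := (Complex.hasSum_ofReal.mpr sr.hasSum).unique s'
  rw [← e, Complex.norm_real]
  refine le_trans (sr.sum_le_tsum u fun n _ => mul_nonneg (ovG_nonneg m n) (pow_nonneg h0 n)) (le_abs_self _)

lemma ov_hasSum (q : ℂ) (hq : ‖q‖ < 1) :
    HasSum (fun n => (((overpartition n : ℕ) : ℝ) : ℂ) * q ^ n) (eu (q ^ 2) / eu q ^ 2) := by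
  have hb := ov_summable ‖q‖ (norm_nonneg q) hq
  have hs : Summable (fun n => (((overpartition n : ℕ) : ℝ) : ℂ) * q ^ n) := by
    refine Summable.of_norm (hb.congr fun n => ?_)
    rw [norm_mul, norm_pow, Complex.norm_real, Real.norm_of_nonneg (Nat.cast_nonneg _)]
  have d := tendsto_tsum_of_dominated_convergence (𝓕 := atTop)
    (f := fun m n => (((ovG m).coeff n : ℝ) : ℂ) * q ^ n)
    (g := fun n => (((overpartition n : ℕ) : ℝ) : ℂ) * q ^ n) hb
    (fun n => ((Complex.continuous_ofReal.tendsto _).comp (ovG_tendsto n)).mul_const _)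
    (Eventually.of_forall fun m n => by
      rw [norm_mul, norm_pow, Complex.norm_real, Real.norm_of_nonneg (ovG_nonneg m n)]
      exact mul_le_mul_of_nonneg_right (ovG_le m n) (by positivity))
  have p := Pb_partial hq
  have e : (fun m => ∑' n, (((ovG m).coeff n : ℝ) : ℂ) * q ^ n) =
      fun m => ∏ j ∈ Finset.range m, ((1 + q ^ (j + 1)) / (1 - q ^ (j + 1))) :=
    funext fun m => (ovG_sum q hq m).2.tsum_eq
  rw [e] at d
  rw [tendsto_nhds_unique p d]
  exact hs.hasSum

lemma Pb_hasSum (z : ℂ) (hz : 0 < z.re) :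
    HasSum (fun n : ℕ => (((overpartition n : ℕ) : ℝ) : ℂ) * cexp (-(n * z))) (Pb z) := by
  refine (ov_hasSum _ (norm_exp_neg_lt z hz)).congr_fun fun n => ?_
  rw [← Complex.exp_nat_mul]
  congr 2
  ring

end genfun

lemma tbS_facts (n : ℕ) (hn : 0 < n) : 0 < (n : ℝ) ^ ((1 : ℝ) / 4) ∧
    tbS (π ^ 2 / 4) n ^ 8 = √(π / 2) / (n : ℝ) ^ ((1 : ℝ) / 4) ∧
    (n : ℝ) ^ ((3 : ℝ) / 4) = ((n : ℝ) ^ ((1 : ℝ) / 4)) ^ 3 ∧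
    √(n : ℝ) = ((n : ℝ) ^ ((1 : ℝ) / 4)) ^ 2 := by
  have hn' : (0 : ℝ) < n := by exact_mod_cast hn
  have hA : 0 < π ^ 2 / 4 := by positivity
  have h1 := tbS_pow (π ^ 2 / 4) hA n hn
  have h2 := tbS_pos (π ^ 2 / 4) hA n hn
  set s := tbS (π ^ 2 / 4) n
  have ht : 0 < (n : ℝ) ^ ((1 : ℝ) / 4) := by positivity
  have h4 : ((n : ℝ) ^ ((1 : ℝ) / 4)) ^ 4 = n := by
    rw [← Real.rpow_natCast, ← Real.rpow_mul hn'.le]; norm_num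
  have h3 : (n : ℝ) ^ ((3 : ℝ) / 4) = ((n : ℝ) ^ ((1 : ℝ) / 4)) ^ 3 := by
    rw [← Real.rpow_natCast, ← Real.rpow_mul hn'.le]; norm_num
  set t := (n : ℝ) ^ ((1 : ℝ) / 4)
  refine ⟨ht, ?_, h3, ?_⟩
  · rw [eq_div_iff ht.ne', eq_comm, Real.sqrt_eq_iff_mul_self_eq (by positivity) (by positivity)]
    have : ((s ^ 8 * t * (s ^ 8 * t))) ^ 2 = (π / 2) ^ 2 := by
      rw [← h4] at h1
      calc _ = t ^ 4 * s ^ 32 := by ring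
        _ = _ := by rw [h1]; ring
    first
    | exact (pow_left_inj₀ (by positivity) (by positivity) two_ne_zero).mp this
    | exact ((pow_left_inj₀ (by positivity) (by positivity) two_ne_zero).mp this).symm
  · rw [Real.sqrt_eq_iff_mul_self_eq (by positivity) (by positivity), ← h4]
    ring

/-- Lemma 3.1: `v(n) ~ e^{π√n}/(16 n^{3/4})` and `v(n) ~ (n^{1/4}/2) p̄(n)` as `n → ∞`. -/
theorem oddBalancedTotal_asymp :
    Tendsto (fun n : ℕ => (oddBalancedTotal n : ℝ) /
      (Real.exp (π * Real.sqrt n) / (16 * (n : ℝ) ^ ((3 : ℝ) / 4)))) atTop (nhds 1) ∧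
    Tendsto (fun n : ℕ => (oddBalancedTotal n : ℝ) /
      ((n : ℝ) ^ ((1 : ℝ) / 4) / 2 * (overpartition n : ℝ))) atTop (nhds 1) := by
  have hA : 0 < π ^ 2 / 4 := by positivity
  have tV := tauber (fun n => (oddBalancedTotal n : ℝ)) Vb Vb_hasSum (π ^ 2 / 4) _ hA 0
    (hmaj_of Vb _ _ 0 V_tendsto') Vb_hmin
  have tP := tauber (fun n => (overpartition n : ℝ)) Pb Pb_hasSum (π ^ 2 / 4) _ hA 8
    (hmaj_of Pb _ _ 8 Pb_tendsto) Pb_hmin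
  have hg : 0 < √(π / 2) := by positivity
  have hg2 : √(π / 2) ^ 2 = π / 2 := Real.sq_sqrt (by positivity)
  have hd : 0 < √(2 : ℝ) := by positivity
  have hd2 : √(2 : ℝ) ^ 2 = 2 := Real.sq_sqrt (by positivity)
  have hpi : √π = √2 * √(π / 2) := by
    rw [← Real.sqrt_mul (by norm_num)]; congr 1; ring
  have hq : √(π / (π ^ 2 / 4)) = 2 / √π := by
    rw [Real.sqrt_eq_iff_mul_self_eq (by positivity) (by positivity)]
    have : √π ^ 2 = π := Real.sq_sqrt (by positivity)
    rw [div_mul_div_comm, ← pow_two √π, this]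
    field_simp
    try norm_num
  have cV : (1 / √2) ^ 3 / 2 * √(π / (π ^ 2 / 4)) = 1 / (4 * √(π / 2)) := by
    rw [hq, hpi]
    have : √(2 : ℝ) ^ 4 = 4 := by
      calc √(2 : ℝ) ^ 4 = (√(2 : ℝ) ^ 2) ^ 2 := by ring
        _ = 4 := by rw [hd2]; norm_num
    rw [← this]
    field_simp
  have cP : 1 / (2 * √π) * √(π / (π ^ 2 / 4)) = 1 / (2 * √(π / 2) ^ 2) := by
    rw [hq, hpi]
    have : 1 / (2 * (√2 * √(π / 2))) * (2 / (√2 * √(π / 2))) = 1 / (√(2 : ℝ) ^ 2 * √(π / 2) ^ 2) := by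
      field_simp
    rw [this, hd2]
  rw [cV] at tV
  rw [cP] at tP
  have hexp : ∀ n : ℕ, 0 < n → 2 * (π ^ 2 / 4) / tbS (π ^ 2 / 4) n ^ 16 = π * √(n : ℝ) := by
    intro n hn
    obtain ⟨ht, h8, h3, h2⟩ := tbS_facts n hn
    rw [h2, show tbS (π ^ 2 / 4) n ^ 16 = (tbS (π ^ 2 / 4) n ^ 8) ^ 2 by ring, h8, div_pow, hg2]
    field_simp
    try norm_num
  constructor
  · have := tV.mul_const (16 * √(π / 2) ^ 3 / (2 * π))
    have e : 1 / (4 * √(π / 2)) * (16 * √(π / 2) ^ 3 / (2 * π)) = 1 := by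
      have : 1 / (4 * √(π / 2)) * (16 * √(π / 2) ^ 3 / (2 * π)) = 2 * √(π / 2) ^ 2 / π := by
        field_simp
        try norm_num
      rw [this, hg2]
      field_simp
    rw [e] at this
    refine this.congr' ?_
    filter_upwards [eventually_gt_atTop 0] with n hn
    obtain ⟨ht, h8, h3, h2⟩ := tbS_facts n hn
    rw [hexp n hn, h3, show tbS (π ^ 2 / 4) n ^ (24 + 0) = (tbS (π ^ 2 / 4) n ^ 8) ^ 3 by ring, h8,
      Real.exp_neg]
    have := Real.exp_pos (π * √(n : ℝ))
    field_simp
  · have := (tV.div tP (by positivity)).mul_const (2 / √(π / 2))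
    have e : 1 / (4 * √(π / 2)) / (1 / (2 * √(π / 2) ^ 2)) * (2 / √(π / 2)) = 1 := by
      field_simp
      try norm_num
    rw [e] at this
    refine this.congr' ?_
    filter_upwards [eventually_gt_atTop 0] with n hn
    obtain ⟨ht, h8, h3, h2⟩ := tbS_facts n hn
    simp only [Pi.div_apply]
    rw [hexp n hn, show tbS (π ^ 2 / 4) n ^ (24 + 0) = (tbS (π ^ 2 / 4) n ^ 8) ^ 3 by ring,
      show tbS (π ^ 2 / 4) n ^ (24 + 8) = (tbS (π ^ 2 / 4) n ^ 8) ^ 4 by ring, h8, Real.exp_neg]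
    have := Real.exp_pos (π * √(n : ℝ))
    by_cases hp : (overpartition n : ℝ) = 0
    · simp [hp]
    field_simp
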